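/- Let k ≥ 2 be an integer and let m, n be distinct elements of N. Then DF(m) = DF(n) if and only if {m, n} is a rational-finite pair, i.e. there exist R ≥ 0 and n_0,…,n_R ∈ ℕ such that {m, n} = { n_0…n_{R−1}(n_R+1)000… , n_0…n_{R−1}n_R∞ }. -/

import Mathlib

open Filter Topology
open scoped Classical

namespace BetaDF

/-- Digit sequences (elements of `Σ = {0,…,k−1}^ℕ` when all entries are `< k`). -/
abbrev Seq : Type := ℕ → ℕ

/-- Lexicographic (strict) order on digit sequences. -/
def seqLt (v w : Seq) : Prop := ∃ r, (∀ s, s < r → v s = w s) ∧ v r < w r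

/-- Lexicographic order on digit sequences. -/
def seqLe (v w : Seq) : Prop := seqLt v w ∨ v = w

/-- The shift map `σ`. -/
def shift (w : Seq) : Seq := fun r => w (r + 1)

/-- Membership in `Σ = {0,…,k−1}^ℕ`. -/
def InSigma (k : ℕ) (w : Seq) : Prop := ∀ r, w r < k

/-- A sequence is maximal if it is `≥` every element of its shift orbit. -/
def IsMaximal (w : Seq) : Prop := ∀ r, seqLe (shift^[r] w) w

/-- Number of occurrences of the digit `i` among the first `r` entries of `w`. -/
def digitCount (w : Seq) (i r : ℕ) : ℕ := ((Finset.range r).filter fun s => w s = i).card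

/-- The ambient Euclidean space `ℝ^k`. -/
abbrev E (k : ℕ) : Type := EuclideanSpace ℝ (Fin k)

/-- The `i`-th coordinate (with junk value `0` for `i ≥ k`). -/
def proj {k : ℕ} (α : E k) (i : ℕ) : ℝ := if h : i < k then α ⟨i, h⟩ else 0

/-- `w` has digit frequency vector `α`. -/
def HasDigitFreq (k : ℕ) (w : Seq) (α : E k) : Prop :=
  ∀ i, i < k →
    Tendsto (fun r => (digitCount w i r : ℝ) / (r : ℝ)) atTop (𝓝 (proj α i))

/-- The standard `(k−1)`-simplex `Δ`. -/
def simplex (k : ℕ) : Set (E k) := {α | (∀ i : Fin k, 0 ≤ α i) ∧ ∑ i, α i = 1}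

/-- The face `F = {α ∈ Δ : α_{k−1} = 0}`. -/
def faceF (k : ℕ) : Set (E k) := {α ∈ simplex k | proj α (k - 1) = 0}

/-- `Δ' = Δ ∖ F`. -/
def simplex' (k : ℕ) : Set (E k) := simplex k \ faceF k

/-- `J(α) = ⌊α₀/α_{k−1}⌋`. -/
noncomputable def Jfun {k : ℕ} (α : E k) : ℕ := ⌊proj α 0 / proj α (k - 1)⌋₊

/-- The map `K_n`. -/
noncomputable def Kmap {k : ℕ} (n : ℕ) (α : E k) : E k :=
  (WithLp.equiv 2 (Fin k → ℝ)).symm fun i =>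
    if (i : ℕ) + 2 < k then proj α ((i : ℕ) + 1) / (1 - proj α 0)
    else if (i : ℕ) + 2 = k then (proj α 0 - n * proj α (k - 1)) / (1 - proj α 0)
    else ((n + 1) * proj α (k - 1) - proj α 0) / (1 - proj α 0)

/-- The continued-fraction map `K : Δ' → Δ'`, `K(α) = K_{J(α)}(α)`. -/
noncomputable def Kstep {k : ℕ} (α : E k) : E k := Kmap (Jfun α) α

/-- The itinerary map `Φ(α)_r = J(K^r(α))`. -/
noncomputable def Phi {k : ℕ} (α : E k) : ℕ → ℕ := fun r => Jfun (Kstep^[r] α)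

/-- The projective embedding `K_n^{-1} : Δ → Δ`. -/
noncomputable def Kinv {k : ℕ} (n : ℕ) (α : E k) : E k :=
  (WithLp.equiv 2 (Fin k → ℝ)).symm fun i =>
    (if (i : ℕ) = 0 then (n + 1) * proj α (k - 2) + n * proj α (k - 1)
      else if (i : ℕ) + 1 = k then proj α (k - 2) + proj α (k - 1)
      else proj α ((i : ℕ) - 1)) /
      ((n + 1) * proj α (k - 2) + n * proj α (k - 1) + 1)

/-- `Υ_{n,r} = K_{n₀}^{-1} ∘ ⋯ ∘ K_{n_r}^{-1}`. -/
noncomputable def Ups {k : ℕ} (n : ℕ → ℕ) : ℕ → E k → E k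
  | 0 => Kinv (n 0)
  | r + 1 => fun α => Ups n r (Kinv (n (r + 1)) α)

/-- `A_{n,r} = Υ_{n,r}(Δ)`. -/
noncomputable def Anr (k : ℕ) (n : ℕ → ℕ) (r : ℕ) : Set (E k) := Ups n r '' simplex k

/-- `F_{n,r} = Υ_{n,r}(F)`. -/
noncomputable def Fnr (k : ℕ) (n : ℕ → ℕ) (r : ℕ) : Set (E k) := Ups n r '' faceF k

/-- Reverse-lexicographic strict order on `ℕ^ℕ`: `a < b` iff `a` exceeds `b`
at the first index where they differ. -/
def revLexLt (a b : ℕ → ℕ) : Prop := ∃ r, (∀ s, s < r → a s = b s) ∧ b r < a r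

/-- The word to which the substitution `Λ_n` sends the digit `i`. -/
def lamWord (k n i : ℕ) : List ℕ :=
  if i + 2 < k then [i + 1]
  else if i + 2 = k then (k - 1) :: List.replicate (n + 1) 0
  else (k - 1) :: List.replicate n 0

/-- The substitution `Λ_n : Σ → Σ`. -/
def lamSub (k n : ℕ) (w : Seq) : Seq := fun m =>
  (((List.range (m + 1)).map fun r => lamWord k n (w r)).flatten).getD m 0

/-- `Λ_{n,r} = Λ_{n₀} ∘ ⋯ ∘ Λ_{n_r}`. -/
def lamChain (k : ℕ) (n : ℕ → ℕ) : ℕ → Seq → Seq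
  | 0 => lamSub k (n 0)
  | r + 1 => fun w => lamChain k n r (lamSub k (n (r + 1)) w)

/-- `Λ_{n₀} ∘ ⋯ ∘ Λ_{n_{R−1}}` for a finite list of indices. -/
def lamList (k : ℕ) : List ℕ → Seq → Seq
  | [], w => w
  | a :: t, w => lamSub k a (lamList k t w)

/-- The constant sequence `(k−1)(k−1)(k−1)…`. -/
def topSeq (k : ℕ) : Seq := fun _ => k - 1

/-- The sequence `(k−1)000…`. -/
def baseSeq (k : ℕ) : Seq := fun m => if m = 0 then k - 1 else 0

/-- `S(n) = lim_{r→∞} Λ_{n,r}((k−1)(k−1)(k−1)…)` (limit in the product topology). -/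
noncomputable def Sseq (k : ℕ) (n : ℕ → ℕ) : Seq :=
  limUnder atTop fun r => lamChain k n r (topSeq k)

/-- The compactified itinerary space `N`: sequences with values in `ℕ∞` such that
all entries from the first `∞` onwards equal `∞`.  Elements with no `∞` entry
correspond to `ℕ^ℕ`; the others are the finite type elements `n₀…n_{R−1}∞`. -/
def NN : Type := {m : ℕ → ℕ∞ // ∀ r, m r = ⊤ → m (r + 1) = ⊤}

/-- Reverse-lexicographic strict order on `N` (`∞` counts as larger than every natural). -/
def nnLt (m n : NN) : Prop := ∃ r, (∀ s, s < r → m.1 s = n.1 s) ∧ n.1 r < m.1 r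

/-- Reverse-lexicographic order on `N`. -/
def nnLe (m n : NN) : Prop := nnLt m n ∨ m = n

/-- The element of `N` determined by an element of `ℕ^ℕ`. -/
def toNN (g : ℕ → ℕ) : NN := ⟨fun r => (g r : ℕ∞), fun r h => absurd h (by simp)⟩

/-- The itinerary `n₀ … n_{R−1} (n_R + 1) 0 0 0 …` (of rational type). -/
def ratSeq (f : ℕ → ℕ) (R : ℕ) : ℕ → ℕ := fun r =>
  if r < R then f r else if r = R then f R + 1 else 0

/-- The finite type element `n₀ … n_{R−1} n_R ∞` of `N`. -/
def finNN (f : ℕ → ℕ) (R : ℕ) : NN :=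
  ⟨fun r => if r ≤ R then (f r : ℕ∞) else ⊤, by
    intro r h
    show (if r + 1 ≤ R then ((f (r + 1) : ℕ∞)) else ⊤) = ⊤
    have h' : (if r ≤ R then ((f r : ℕ∞)) else ⊤) = ⊤ := h
    by_cases h1 : r ≤ R
    · rw [if_pos h1] at h'
      exact absurd h' (by simp)
    · rw [if_neg (by omega : ¬ r + 1 ≤ R)]⟩

/-- The extension of `S` to `N`. -/
noncomputable def SN (k : ℕ) (m : NN) : Seq :=
  if h : ∃ R, m.1 R = ⊤ then
    lamList k ((List.range (Nat.find h)).map fun r => (m.1 r).toNat) (baseSeq k)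
  else Sseq k fun r => (m.1 r).toNat

/-- The metric `d(m,n) = 2^{−X(m,n)}` on `N`, where
`X(m,n) = r + min(m₀+⋯+m_r, n₀+⋯+n_r)` and `r` is the first index where `m,n` differ. -/
noncomputable def dN (m n : NN) : ℝ :=
  if h : m = n then 0
  else
    have hex : ∃ r, m.1 r ≠ n.1 r := by
      by_contra hc
      push_neg at hc
      exact h (Subtype.ext (funext hc))
    (2 : ℝ) ^ (-(((Nat.find hex : ℕ) : ℤ) +
      ((min (∑ s ∈ Finset.range (Nat.find hex + 1), m.1 s)
            (∑ s ∈ Finset.range (Nat.find hex + 1), n.1 s)).toNat : ℤ)))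

/-- The symbolic β-shift `X(w)`. -/
def Xset (k : ℕ) (w : Seq) : Set Seq :=
  {v | InSigma k v ∧ ∀ r, seqLe (shift^[r] v) w}

/-- The digit frequency set `DF(w)` of the symbolic β-shift `X(w)`. -/
def DFw (k : ℕ) (w : Seq) : Set (E k) :=
  {α | α ∈ simplex k ∧ ∃ v ∈ Xset k w, HasDigitFreq k v α}

/-- `DF(n) = DF(S(n))` for `n ∈ ℕ^ℕ`. -/
noncomputable def DFn (k : ℕ) (n : ℕ → ℕ) : Set (E k) := DFw k (Sseq k n)

/-- `DF(n) = DF(S(n))` for `n ∈ N`. -/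
noncomputable def DFN (k : ℕ) (m : NN) : Set (E k) := DFw k (SN k m)

/-- The infimax map `I = S ∘ Φ` on `Δ'`, extended by `I(α) = (k−1)000…` on `F`. -/
noncomputable def Ifun (k : ℕ) (α : E k) : Seq :=
  if α ∈ simplex' k then Sseq k (Phi α) else baseSeq k

/-- The simplex `T_m = {α ∈ Δ : (m+1)α_{k−1} ≤ α₀}`. -/
def Tset (k m : ℕ) : Set (E k) :=
  {α ∈ simplex k | ((m : ℝ) + 1) * proj α (k - 1) ≤ proj α 0}

/-- The standard basis vector `e_i`. -/
noncomputable def evec (k i : ℕ) : E k :=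
  (WithLp.equiv 2 (Fin k → ℝ)).symm fun j => if (j : ℕ) = i then 1 else 0

/-- The rational extreme points
`FE(n) = {Υ_{n,s}(e_{k−2}) : n_{s+t} ≠ 0 for some 1 ≤ t ≤ k−2}`. -/
noncomputable def FEset (k : ℕ) (n : ℕ → ℕ) : Set (E k) :=
  {α | ∃ s, (∃ t, 1 ≤ t ∧ t ≤ k - 2 ∧ n (s + t) ≠ 0) ∧ α = Ups n s (evec k (k - 2))}

/-- The set `E(n)` of non-trivial extreme points of `DF(n)`:
extreme points other than `e₀,…,e_{k−2}`. -/
noncomputable def Eset (k : ℕ) (n : ℕ → ℕ) : Set (E k) :=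
  Set.extremePoints ℝ (DFn k n) \ {α | ∃ i, i ≤ k - 2 ∧ α = evec k i}

/-- The fiber `Φ^{-1}(n) ⊆ Δ'`. -/
noncomputable def PhiFiber (k : ℕ) (n : ℕ → ℕ) : Set (E k) :=
  {α ∈ simplex' k | Phi α = n}

/-- `f_β(x) = βx mod 1`. -/
noncomputable def fbeta (β x : ℝ) : ℝ := Int.fract (β * x)

/-- The digit sequence of the greedy β-expansion of `x`: `d_β(x)_r = ⌊β f_β^r(x)⌋`. -/
noncomputable def dbeta (β : ℝ) (x : ℝ) : Seq := fun r => ⌊β * (fbeta β)^[r] x⌋₊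

/-- The digit frequency set `DF(β)` of β-expansions of points of `[0,1]`. -/
noncomputable def DFbeta (k : ℕ) (β : ℝ) : Set (E k) :=
  {α | α ∈ simplex k ∧ ∃ x ∈ Set.Icc (0 : ℝ) 1, HasDigitFreq k (dbeta β x) α}

/-- The sequence `w_β`: if `d_β(1) = d₁…d_{r−1}d_r000…` with `d_r > 0` then `w_β`
is the infinite repetition of `d₁…d_{r−1}(d_r − 1)`; otherwise `w_β = d_β(1)`. -/
noncomputable def wbeta (β : ℝ) : Seq :=
  if h : ∃ r, dbeta β 1 r ≠ 0 ∧ ∀ s, r < s → dbeta β 1 s = 0 then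
    fun m =>
      if m % (Nat.find h + 1) = Nat.find h then dbeta β 1 (Nat.find h) - 1
      else dbeta β 1 (m % (Nat.find h + 1))
  else dbeta β 1

/-- `DF` extended to `[k−1,k]` by `DF(k−1) = F` and `DF(k) = Δ`. -/
noncomputable def DFext (k : ℕ) (β : ℝ) : Set (E k) :=
  if β ≤ (k : ℝ) - 1 then faceF k
  else if (k : ℝ) ≤ β then simplex k
  else DFbeta k β

/-- The mode-locking interval `I_{n₀…n_R}` determined by the word `f 0, …, f R`. -/
noncomputable def Iint (k : ℕ) (f : ℕ → ℕ) (R : ℕ) : Set ℝ :=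
  {β | (k : ℝ) - 1 < β ∧ β < k ∧
    seqLe (Sseq k (ratSeq f R)) (wbeta β) ∧ seqLe (wbeta β) (SN k (finNN f R))}

/-- The frequency vector of the first `s` digits of `w`. -/
noncomputable def freqVec (k : ℕ) (w : Seq) (s : ℕ) : E k :=
  (WithLp.equiv 2 (Fin k → ℝ)).symm fun i => (digitCount w (i : ℕ) s : ℝ) / (s : ℝ)


/-! ### Sequences and finite words -/

/-- Prepend a letter to a sequence. -/
def scons (a : ℕ) (s : Seq) : Seq
  | 0 => a
  | i + 1 => s i

/-- Prepend a word to a sequence. -/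
def app : List ℕ → Seq → Seq
  | [], s => s
  | a :: x, s => scons a (app x s)

/-- Comparison of a finite word with a sequence: the word is not larger than the
corresponding prefix of the sequence. -/
def le : List ℕ → Seq → Prop
  | [], _ => True
  | a :: x, s => a < s 0 ∨ (a = s 0 ∧ le x (shift s))

/-- All suffixes of the word are `≤ w`. -/
def Adm (w : Seq) : List ℕ → Prop
  | [] => True
  | a :: x => le (a :: x) w ∧ Adm w x

/-- All suffixes `z` of the word satisfy `z w ≤ w`. -/
def Prep (w : Seq) : List ℕ → Prop
  | [] => True
  | a :: x => seqLe (app (a :: x) w) w ∧ Prep w x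

/-- The substitution on finite words. -/
def lamL (k n : ℕ) (u : List ℕ) : List ℕ := u.flatMap (lamWord k n)

@[simp] lemma scons_zero (a : ℕ) (s : Seq) : scons a s 0 = a := rfl
@[simp] lemma scons_succ (a : ℕ) (s : Seq) (i : ℕ) : scons a s (i + 1) = s i := rfl
@[simp] lemma shift_scons (a : ℕ) (s : Seq) : shift (scons a s) = s := rfl
@[simp] lemma shift_apply (s : Seq) (i : ℕ) : shift s i = s (i + 1) := rfl
@[simp] lemma app_nil (s : Seq) : app [] s = s := rfl
@[simp] lemma app_cons (a : ℕ) (x : List ℕ) (s : Seq) : app (a :: x) s = scons a (app x s) := rfl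

lemma scons_shift (s : Seq) : scons (s 0) (shift s) = s := by
  funext i; cases i <;> rfl

lemma app_append (x y : List ℕ) (s : Seq) : app (x ++ y) s = app x (app y s) := by
  induction x with
  | nil => rfl
  | cons a x ih => simp [ih]

lemma app_apply (x : List ℕ) (s : Seq) (i : ℕ) :
    app x s i = if i < x.length then x.getD i 0 else s (i - x.length) := by
  induction x generalizing i with
  | nil => simp
  | cons a x ih =>
    cases i with
    | zero => simp
    | succ i => simp [ih]

lemma lamWord_ne_nil (k n i : ℕ) : lamWord k n i ≠ [] := by
  unfold lamWord; split_ifs <;> simp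

lemma lamWord_length_pos (k n i : ℕ) : 0 < (lamWord k n i).length :=
  List.length_pos_iff.2 (lamWord_ne_nil k n i)

lemma flatten_range_length (W : ℕ → List ℕ) (hW : ∀ r, 0 < (W r).length) (N : ℕ) :
    N ≤ (((List.range N).map W).flatten).length := by
  induction N with
  | zero => simp
  | succ N ih =>
    have := hW N
    rw [List.range_succ, List.map_append, List.flatten_append, List.length_append]
    simp only [List.map_cons, List.map_nil, List.flatten_cons, List.flatten_nil, List.append_nil]
    omega

lemma flatten_range_stable (W : ℕ → List ℕ) (hW : ∀ r, 0 < (W r).length) (m d : ℕ) :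
    (((List.range (m + 1 + d)).map W).flatten).getD m 0
      = (((List.range (m + 1)).map W).flatten).getD m 0 := by
  induction d with
  | zero => rfl
  | succ d ih =>
    rw [← ih, ← Nat.add_assoc, List.range_succ, List.map_append, List.flatten_append]
    apply List.getD_append
    have := flatten_range_length W hW (m + 1 + d)
    omega

lemma lamSub_cons (k n : ℕ) (w : Seq) :
    lamSub k n w = app (lamWord k n (w 0)) (lamSub k n (shift w)) := by
  funext m
  have hpos := lamWord_length_pos k n (w 0)
  rw [app_apply]
  unfold lamSub
  rw [List.range_succ_eq_map, List.map_cons, List.flatten_cons, List.map_map]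
  split_ifs with h
  · rw [List.getD_append _ _ _ _ h]
  · push Not at h
    rw [List.getD_append_right _ _ _ _ h]
    obtain ⟨d, hd⟩ : ∃ d, m = (m - (lamWord k n (w 0)).length) + 1 + d :=
      ⟨(lamWord k n (w 0)).length - 1, by omega⟩
    have := flatten_range_stable (fun r => lamWord k n (shift w r))
      (fun r => lamWord_length_pos _ _ _) (m - (lamWord k n (w 0)).length) d
    rw [← hd] at this
    exact this

lemma lamSub_app (k n : ℕ) (x : List ℕ) (s : Seq) :
    lamSub k n (app x s) = app (lamL k n x) (lamSub k n s) := by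
  induction x with
  | nil => rfl
  | cons a x ih =>
    rw [lamSub_cons, app_cons, shift_scons, ih, scons_zero, ← app_append]
    rfl

/-! ### Order lemmas -/

lemma seqLe_refl (s : Seq) : seqLe s s := Or.inr rfl

lemma seqLt_trans {a b c : Seq} (h1 : seqLt a b) (h2 : seqLt b c) : seqLt a c := by
  obtain ⟨r, hr, hr'⟩ := h1
  obtain ⟨t, ht, ht'⟩ := h2
  rcases lt_trichotomy r t with h | h | h
  · exact ⟨r, fun s hs => (hr s hs).trans (ht s (hs.trans h)), by rw [← ht r h]; exact hr'⟩
  · subst h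
    exact ⟨r, fun s hs => (hr s hs).trans (ht s hs), hr'.trans ht'⟩
  · exact ⟨t, fun s hs => (hr s (hs.trans h)).trans (ht s hs), by rw [hr t h]; exact ht'⟩

lemma seqLe_trans {a b c : Seq} (h1 : seqLe a b) (h2 : seqLe b c) : seqLe a c := by
  rcases h1 with h1 | rfl
  · rcases h2 with h2 | rfl
    · exact Or.inl (seqLt_trans h1 h2)
    · exact Or.inl h1
  · exact h2

lemma seqLt_of_zero {a b : Seq} (h : a 0 < b 0) : seqLt a b :=
  ⟨0, fun s hs => absurd hs (Nat.not_lt_zero _), h⟩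

lemma seqLe_of_zero {a b : Seq} (h : a 0 < b 0) : seqLe a b := Or.inl (seqLt_of_zero h)

lemma seqLt_scons {a b : Seq} (c : ℕ) (h : seqLt a b) : seqLt (scons c a) (scons c b) := by
  obtain ⟨r, hr, hr'⟩ := h
  refine ⟨r + 1, fun s hs => ?_, hr'⟩
  cases s with
  | zero => rfl
  | succ s => exact hr s (by omega)

lemma seqLt_app {a b : Seq} (x : List ℕ) (h : seqLt a b) : seqLt (app x a) (app x b) := by
  induction x with
  | nil => exact h
  | cons c x ih => exact seqLt_scons c ih

lemma seqLe_app {a b : Seq} (x : List ℕ) (h : seqLe a b) : seqLe (app x a) (app x b) := by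
  rcases h with h | rfl
  · exact Or.inl (seqLt_app x h)
  · exact seqLe_refl _

lemma seqLe_iff (a b : Seq) : seqLe a b ↔ a 0 < b 0 ∨ (a 0 = b 0 ∧ seqLe (shift a) (shift b)) := by
  constructor
  · rintro (⟨r, hr, hr'⟩ | rfl)
    · cases r with
      | zero => exact Or.inl hr'
      | succ r =>
        exact Or.inr ⟨hr 0 (Nat.succ_pos _), Or.inl ⟨r, fun s hs => hr (s + 1) (by omega), hr'⟩⟩
    · exact Or.inr ⟨rfl, seqLe_refl _⟩
  · rintro (h | ⟨h, h'⟩)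
    · exact seqLe_of_zero h
    · rw [← scons_shift a, ← scons_shift b, h]
      rcases h' with h' | h'
      · exact Or.inl (seqLt_scons _ h')
      · rw [h']; exact seqLe_refl _

/-- Prefix of a sequence as a list. -/
def pre (s : Seq) (t : ℕ) : List ℕ := (List.range t).map s

lemma pre_succ (s : Seq) (t : ℕ) : pre s (t + 1) = s 0 :: pre (shift s) t := by
  unfold pre
  rw [List.range_succ_eq_map, List.map_cons, List.map_map]
  rfl

lemma le_pre_of_seqLe {a b : Seq} (h : seqLe a b) (t : ℕ) : le (pre a t) b := by
  induction t generalizing a b with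
  | zero => trivial
  | succ t ih =>
    rw [pre_succ]
    rcases (seqLe_iff a b).1 h with h | ⟨h, h'⟩
    · exact Or.inl h
    · exact Or.inr ⟨h, ih h'⟩

lemma seqLe_total (a b : Seq) : seqLe a b ∨ seqLt b a := by
  by_cases h : a = b
  · exact Or.inl (Or.inr h)
  · have hex : ∃ r, a r ≠ b r := by
      by_contra hc
      push Not at hc
      exact h (funext hc)
    have h1 := Nat.find_spec hex
    have h2 : ∀ s, s < Nat.find hex → a s = b s := fun s hs => by
      have := Nat.find_min hex hs
      push Not at this
      exact this
    rcases lt_or_gt_of_ne h1 with h3 | h3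
    · exact Or.inl (Or.inl ⟨_, h2, h3⟩)
    · exact Or.inr ⟨_, fun s hs => (h2 s hs).symm, h3⟩

/-- `≤ w` is a closed condition. -/
lemma seqLe_of_agree {a w : Seq} (h : ∀ t, ∃ b, seqLe b w ∧ ∀ s, s < t → a s = b s) :
    seqLe a w := by
  rcases seqLe_total a w with h1 | ⟨r, hr, hr'⟩
  · exact h1
  · exfalso
    obtain ⟨b, hb, hab⟩ := h (r + 1)
    have hlt : seqLt w b :=
      ⟨r, fun s hs => (hr s hs).trans (hab s (by omega)), by rw [← hab r (by omega)]; exact hr'⟩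
    rcases hb with hb | rfl
    · obtain ⟨t, _, ht⟩ := seqLt_trans hlt hb
      exact lt_irrefl _ ht
    · obtain ⟨t, _, ht⟩ := hlt
      exact lt_irrefl _ ht

/-! ### The substitution -/

lemma lamWord_low {k n i : ℕ} (h : i + 2 < k) : lamWord k n i = [i + 1] := if_pos h

lemma lamWord_mid {k : ℕ} (hk : 2 ≤ k) (n : ℕ) :
    lamWord k n (k - 2) = (k - 1) :: List.replicate (n + 1) 0 := by
  unfold lamWord
  rw [if_neg (by omega), if_pos (by omega)]

lemma lamWord_top {k : ℕ} (hk : 2 ≤ k) (n : ℕ) :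
    lamWord k n (k - 1) = (k - 1) :: List.replicate n 0 := by
  unfold lamWord
  rw [if_neg (by omega), if_neg (by omega)]

lemma lamWord_lt {k : ℕ} (hk : 2 ≤ k) (n i : ℕ) : ∀ a ∈ lamWord k n i, a < k := by
  intro a ha
  unfold lamWord at ha
  split_ifs at ha with h1 h2
  · simp at ha; omega
  · rcases List.mem_cons.1 ha with h | h
    · omega
    · have := List.eq_of_mem_replicate h; omega
  · rcases List.mem_cons.1 ha with h | h
    · omega
    · have := List.eq_of_mem_replicate h; omega

lemma lamL_lt {k : ℕ} (hk : 2 ≤ k) (n : ℕ) (u : List ℕ) : ∀ a ∈ lamL k n u, a < k := by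
  intro a ha
  obtain ⟨i, _, hi⟩ := List.mem_flatMap.1 ha
  exact lamWord_lt hk n i a hi

lemma lamL_cons (k n a : ℕ) (u : List ℕ) : lamL k n (a :: u) = lamWord k n a ++ lamL k n u := rfl

lemma lamL_ne_nil {k n : ℕ} {u : List ℕ} (h : u ≠ []) : lamL k n u ≠ [] := by
  cases u with
  | nil => exact absurd rfl h
  | cons a u =>
    rw [lamL_cons]
    intro h'
    exact lamWord_ne_nil k n a (List.append_eq_nil_iff.1 h').1

lemma lamSub_zero {k : ℕ} (hk : 2 ≤ k) (n : ℕ) (w : Seq) :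
    lamSub k n w 0 = if w 0 + 2 < k then w 0 + 1 else k - 1 := by
  rw [lamSub_cons]
  unfold lamWord
  split_ifs <;> rfl

lemma lamSub_zero_pos {k : ℕ} (hk : 2 ≤ k) (n : ℕ) (w : Seq) : 0 < lamSub k n w 0 := by
  rw [lamSub_zero hk]; split_ifs <;> omega

lemma lamSub_inSigma {k : ℕ} (hk : 2 ≤ k) (n : ℕ) (w : Seq) : InSigma k (lamSub k n w) := by
  intro r
  induction r using Nat.strong_induction_on generalizing w with
  | _ r ih =>
    rw [lamSub_cons, app_apply]
    have hpos := lamWord_length_pos k n (w 0)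
    split_ifs with h
    · apply lamWord_lt hk n (w 0)
      rw [List.getD_eq_getElem _ _ h]
      exact List.getElem_mem h
    · exact ih _ (by omega) _

lemma lamSub_lt {k : ℕ} (hk : 2 ≤ k) (n : ℕ) {v w : Seq} (hw : InSigma k w) (h : seqLt v w) :
    seqLt (lamSub k n v) (lamSub k n w) := by
  obtain ⟨r, hr, hr'⟩ := h
  induction r generalizing v w with
  | zero =>
    have hw0 := hw 0
    by_cases h1 : v 0 + 2 < k
    · apply seqLt_of_zero
      rw [lamSub_zero hk, lamSub_zero hk, if_pos h1]
      split_ifs <;> omega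
    · have hv : v 0 = k - 2 := by omega
      have hw' : w 0 = k - 1 := by omega
      rw [lamSub_cons, lamSub_cons k n w, hv, hw', lamWord_mid hk, lamWord_top hk,
        List.replicate_succ', ← List.cons_append, app_append]
      exact seqLt_app _ (seqLt_of_zero (lamSub_zero_pos hk n _))
  | succ r ih =>
    rw [lamSub_cons, lamSub_cons k n w, hr 0 (Nat.succ_pos _)]
    exact seqLt_app _ (ih (fun i => hw (i + 1)) (fun s hs => hr (s + 1) (by omega)) hr')

lemma lamSub_le {k : ℕ} (hk : 2 ≤ k) (n : ℕ) {v w : Seq} (hw : InSigma k w) (h : seqLe v w) :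
    seqLe (lamSub k n v) (lamSub k n w) := by
  rcases h with h | rfl
  · exact Or.inl (lamSub_lt hk n hw h)
  · exact seqLe_refl _

/-! ### The rearrangement lemma -/

lemma le_replicate_zero (j : ℕ) (s : Seq) : le (List.replicate j 0) s := by
  induction j generalizing s with
  | zero => trivial
  | succ j ih =>
    rw [List.replicate_succ]
    rcases Nat.eq_zero_or_pos (s 0) with h | h
    · exact Or.inr ⟨h.symm, ih _⟩
    · exact Or.inl h

lemma le_append_zeros {x : List ℕ} {s : Seq} (h : le x s) (j : ℕ) :
    le (x ++ List.replicate j 0) s := by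
  induction x generalizing s with
  | nil => exact le_replicate_zero j s
  | cons a x ih =>
    rcases h with h | ⟨h, h'⟩
    · exact Or.inl h
    · exact Or.inr ⟨h, ih h'⟩

lemma le_cons_mono {x y : List ℕ} (h : ∀ s, le x s → le y s) (a : ℕ) (s : Seq)
    (hx : le (a :: x) s) : le (a :: y) s := by
  rcases hx with h1 | ⟨h1, h2⟩
  · exact Or.inl h1
  · exact Or.inr ⟨h1, h _ h2⟩

lemma le_moveback {b : ℕ} (hb : 0 < b) (i l : ℕ) (Y : List ℕ) (s : Seq)
    (h : le (b :: (List.replicate (i + l) 0 ++ Y)) s) :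
    le (List.replicate i 0 ++ (b :: (List.replicate l 0 ++ Y))) s := by
  cases i with
  | zero => simpa using h
  | succ i =>
    have : 0 < s 0 := by
      rcases h with h1 | ⟨h1, _⟩ <;> omega
    exact Or.inl this

lemma le_app_cancel (x y : List ℕ) (s : Seq) (h : le (x ++ y) (app x s)) : le y s := by
  induction x with
  | nil => exact h
  | cons a x ih =>
    rcases h with h | ⟨_, h⟩
    · exact absurd h (lt_irrefl _)
    · exact ih h

lemma le_head {a : ℕ} {x : List ℕ} {s : Seq} (h : le (a :: x) s) : a ≤ s 0 := by
  rcases h with h | ⟨h, _⟩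
  · exact h.le
  · exact h.le

lemma le_zeros {x : List ℕ} {n : ℕ} {s : Seq} (h : le x (app (List.replicate n 0) s)) :
    ∀ i, i < n → x.getD i 0 = 0 := by
  induction n generalizing x with
  | zero => intro i hi; omega
  | succ n ih =>
    intro i hi
    cases x with
    | nil => simp
    | cons a x =>
      rw [List.replicate_succ] at h
      rcases h with h | ⟨h, h'⟩
      · exact absurd h (Nat.not_lt_zero _)
      · cases i with
        | zero => simpa using h
        | succ i => simpa using ih h' i (by omega)

lemma adm_le {w : Seq} {x : List ℕ} (h : Adm w x) : ∀ a ∈ x, a ≤ w 0 := by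
  induction x with
  | nil => intro a ha; simp at ha
  | cons b x ih =>
    intro a ha
    rcases List.mem_cons.1 ha with rfl | ha
    · exact le_head h.1
    · exact ih h.2 a ha

lemma lamWord_head {k : ℕ} (n i : ℕ) :
    ∃ t, lamWord k n i = (if i + 2 < k then i + 1 else k - 1) :: t := by
  unfold lamWord
  split_ifs <;> exact ⟨_, rfl⟩

lemma getLast?_cons_ne {c a : ℕ} {u : List ℕ} (h : (a :: u).getLast? ≠ some c) :
    u.getLast? ≠ some c := by
  cases u with
  | nil => simp
  | cons b u => simpa [List.getLast?_cons_cons] using h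

lemma le_reflect {k : ℕ} (hk : 2 ≤ k) (n : ℕ) (u : List ℕ) (w : Seq)
    (hu : ∀ a ∈ u, a < k) (hlast : u.getLast? ≠ some (k - 1))
    (h : le (lamL k n u) (lamSub k n w)) : le u w := by
  induction u generalizing w with
  | nil => trivial
  | cons a u ih =>
    have hak : a < k := hu a (by simp)
    rcases lt_trichotomy a (w 0) with h1 | h1 | h1
    · exact Or.inl h1
    · refine Or.inr ⟨h1, ih _ (fun b hb => hu b (by simp [hb])) (getLast?_cons_ne hlast) ?_⟩
      rw [lamSub_cons, lamL_cons, ← h1] at h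
      exact le_app_cancel _ _ _ h
    · exfalso
      by_cases h2 : w 0 + 2 < k
      · rw [lamL_cons] at h
        obtain ⟨t, ht⟩ := lamWord_head (k := k) n a
        rw [ht, List.cons_append] at h
        have := le_head h
        rw [lamSub_zero hk, if_pos h2] at this
        split_ifs at this <;> omega
      · have hw : w 0 = k - 2 := by omega
        have ha : a = k - 1 := by omega
        subst ha
        rw [lamSub_cons, lamL_cons, hw, lamWord_mid hk, lamWord_top hk,
          List.replicate_succ', ← List.cons_append, app_append] at h
        have h3 := le_app_cancel _ _ _ h
        cases u with
        | nil => simp at hlast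
        | cons b u =>
          rw [lamL_cons] at h3
          obtain ⟨t, ht⟩ := lamWord_head (k := k) n b
          rw [ht, List.cons_append] at h3
          have := le_head h3
          simp only [app_cons, scons_zero] at this
          split_ifs at this <;> omega

lemma core_aux {k : ℕ} (hk : 2 ≤ k) (n : ℕ) (w : Seq) (hw0 : w 0 = k - 1)
    (x : List ℕ) (hx : Adm (lamSub k n w) x) :
    ∃ (u : List ℕ) (e : ℕ), Adm w u ∧
      (x ++ List.replicate (n + 1) 0).Perm (List.replicate e 0 ++ lamL k n u) ∧
      (∀ s, le (x ++ List.replicate (n + 1) 0) s → le (List.replicate e 0 ++ lamL k n u) s) ∧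
      (u = [] → n + 1 ≤ e) ∧ u.getLast? ≠ some (k - 1) ∧
      (∀ j, j ≤ n + 1 → (∀ i, i < j → x.getD i 0 = 0) → j ≤ e) := by
  induction x with
  | nil =>
    refine ⟨[], n + 1, trivial, ?_, ?_, ?_, ?_, ?_⟩ <;> simp [lamL]
  | cons a x ih =>
    obtain ⟨u, e, h1, h2, h3, h4, h5, h6⟩ := ih hx.2
    have hle := hx.1
    have hL0 : lamSub k n w 0 = k - 1 := by
      rw [lamSub_zero hk, hw0, if_neg (by omega)]
    have ha : a ≤ k - 1 := by rw [← hL0]; exact le_head hle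
    have hj0 : a ≠ 0 → ∀ (e' : ℕ), ∀ j, j ≤ n + 1 → (∀ i, i < j → (a :: x).getD i 0 = 0) →
        j ≤ e' := by
      intro ha0 e' j _ hj
      cases j with
      | zero => exact Nat.zero_le _
      | succ j => exact absurd (by simpa using hj 0 (Nat.succ_pos _)) ha0
    have hlast' : ∀ b, (u = [] → b ≠ k - 1) → (b :: u).getLast? ≠ some (k - 1) := by
      intro b hb
      cases u with
      | nil => simpa using hb rfl
      | cons c u => simpa [List.getLast?_cons_cons] using h5
    by_cases ha0 : a = 0
    · subst ha0
      refine ⟨u, e + 1, h1, ?_, ?_, ?_, h5, ?_⟩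
      · exact h2.cons 0
      · intro s hs
        rw [List.replicate_succ, List.cons_append]
        exact le_cons_mono h3 0 s hs
      · intro hu; have := h4 hu; omega
      · intro j hj hj'
        cases j with
        | zero => omega
        | succ j =>
          have := h6 j (by omega) (fun i hi => by simpa using hj' (i + 1) (by omega))
          omega
    by_cases hak : a < k - 1
    · have hw1 : lamWord k n (a - 1) = [a] := by
        rw [lamWord_low (by omega)]; congr 1; omega
      refine ⟨(a - 1) :: u, e, ⟨Or.inl (by omega), h1⟩, ?_, ?_, by simp,
        hlast' _ (fun _ => by omega), hj0 ha0 e⟩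
      · rw [lamL_cons, hw1, List.cons_append]
        exact (h2.cons a).trans (List.perm_middle.symm)
      · intro s hs
        rw [lamL_cons, hw1]
        have := le_cons_mono h3 a s hs
        exact le_moveback (by omega) e 0 _ s (by simpa using this)
    have hak' : a = k - 1 := by omega
    subst hak'
    by_cases he : n + 1 ≤ e
    · obtain ⟨d, rfl⟩ : ∃ d, e = d + (n + 1) := ⟨e - (n + 1), by omega⟩
      refine ⟨(k - 2) :: u, d, ⟨Or.inl (by omega), h1⟩, ?_, ?_, by simp,
        hlast' _ (fun _ => by omega), hj0 ha0 d⟩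
      · rw [lamL_cons, lamWord_mid hk, List.cons_append, List.cons_append]
        refine (h2.cons _).trans ?_
        rw [← List.replicate_append_replicate, List.append_assoc]
        exact List.perm_middle.symm
      · intro s hs
        rw [lamL_cons, lamWord_mid hk, List.cons_append]
        exact le_moveback (by omega) d (n + 1) _ s (le_cons_mono h3 _ s hs)
    · have hle' := hle
      rw [lamSub_cons, hw0, lamWord_top hk] at hle'
      have hxz : le x (app (List.replicate n 0) (lamSub k n (shift w))) := by
        rcases hle' with h | ⟨_, h⟩
        · exact absurd h (lt_irrefl _)
        · exact h
      have hen : e = n := by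
        have := h6 n (by omega) (le_zeros hxz)
        omega
      subst hen
      have hu : u ≠ [] := fun hu => he (h4 hu)
      have hlast := hlast' (k - 1) (fun h => absurd h hu)
      have hper : lamL k e ((k - 1) :: u) = (k - 1) :: (List.replicate e 0 ++ lamL k e u) := by
        rw [lamL_cons, lamWord_top hk, List.cons_append]
      have key : ∀ s, le (((k - 1) :: x) ++ List.replicate (e + 1) 0) s →
          le (List.replicate 0 0 ++ lamL k e ((k - 1) :: u)) s := by
        intro s hs
        rw [hper]
        exact le_cons_mono h3 _ s hs
      refine ⟨(k - 1) :: u, 0, ⟨?_, h1⟩, ?_, key, by simp, hlast, hj0 ha0 0⟩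
      · apply le_reflect hk e _ w _ hlast (key _ (le_append_zeros hle _))
        intro b hb
        rcases List.mem_cons.1 hb with rfl | hb
        · omega
        · have := adm_le h1 b hb
          omega
      · rw [hper]
        exact h2.cons _

lemma core {k : ℕ} (hk : 2 ≤ k) (n : ℕ) (w : Seq) (hw0 : w 0 = k - 1)
    (x : List ℕ) (hx : Adm (lamSub k n w) x) :
    ∃ (u : List ℕ) (e : ℕ), Adm w u ∧
      (x ++ List.replicate (n + 1) 0).Perm (List.replicate e 0 ++ lamL k n u) := by
  obtain ⟨u, e, h1, h2, _⟩ := core_aux hk n w hw0 x hx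
  exact ⟨u, e, h1, h2⟩

/-! ### Linear functionals -/

/-- Sum of a weight over the letters of a word. -/
def wsum (L : ℕ → ℤ) (x : List ℕ) : ℤ := (x.map L).sum

/-- The weight is bounded below on admissible words. -/
def Good (w : Seq) (L : ℕ → ℤ) : Prop := ∃ C : ℤ, ∀ x, Adm w x → -C ≤ wsum L x

/-- Transported weight. -/
def pull (k n : ℕ) (L : ℕ → ℤ) : ℕ → ℤ := fun i =>
  if i = 0 then L (k - 2) - L (k - 1)
  else if i = k - 1 then L (k - 1) - n * (L (k - 2) - L (k - 1))
  else L (i - 1)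

/-- Sign conditions on weights. -/
def InvL (k : ℕ) (L : ℕ → ℤ) : Prop := L (k - 1) ≤ 0 ∧ ∀ i, i < k → L (k - 1) ≤ L i

lemma wsum_append (L : ℕ → ℤ) (x y : List ℕ) : wsum L (x ++ y) = wsum L x + wsum L y := by
  simp [wsum]

lemma wsum_replicate (L : ℕ → ℤ) (n a : ℕ) : wsum L (List.replicate n a) = n * L a := by
  simp [wsum]

lemma wsum_cons (L : ℕ → ℤ) (a : ℕ) (x : List ℕ) : wsum L (a :: x) = L a + wsum L x := by
  simp [wsum]

lemma wsum_perm (L : ℕ → ℤ) {x y : List ℕ} (h : x.Perm y) : wsum L x = wsum L y :=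
  (h.map L).sum_eq

lemma wsum_pull_word {k : ℕ} (hk : 2 ≤ k) (n : ℕ) (L : ℕ → ℤ) (i : ℕ) (hi : i < k) :
    wsum (pull k n L) (lamWord k n i) = L i := by
  have h0 : pull k n L 0 = L (k - 2) - L (k - 1) := by simp [pull]
  have h1 : pull k n L (k - 1) = L (k - 1) - n * (L (k - 2) - L (k - 1)) := by
    unfold pull; rw [if_neg (by omega), if_pos rfl]
  rcases lt_or_ge (i + 2) k with h | h
  · rw [lamWord_low h, wsum_cons]
    have : pull k n L (i + 1) = L i := by
      unfold pull; rw [if_neg (by omega), if_neg (by omega)]; rfl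
    rw [this]; simp [wsum]
  · by_cases h2 : i = k - 2
    · subst h2
      rw [lamWord_mid hk, wsum_cons, wsum_replicate, h0, h1]; push_cast; ring
    · have h3 : i = k - 1 := by omega
      subst h3
      rw [lamWord_top hk, wsum_cons, wsum_replicate, h0, h1]; ring

lemma wsum_pull {k : ℕ} (hk : 2 ≤ k) (n : ℕ) (L : ℕ → ℤ) (u : List ℕ) (hu : ∀ a ∈ u, a < k) :
    wsum (pull k n L) (lamL k n u) = wsum L u := by
  induction u with
  | nil => rfl
  | cons a u ih =>
    rw [lamL_cons, wsum_append, wsum_cons, wsum_pull_word hk n L a (hu a (by simp)),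
      ih (fun b hb => hu b (by simp [hb]))]

lemma invL_pull {k : ℕ} (hk : 2 ≤ k) (n : ℕ) {L : ℕ → ℤ} (h : InvL k L) :
    InvL k (pull k n L) := by
  obtain ⟨h1, h2⟩ := h
  have h3 := h2 (k - 2) (by omega)
  have h4 : 0 ≤ (n : ℤ) * (L (k - 2) - L (k - 1)) := by
    apply mul_nonneg <;> omega
  have e1 : pull k n L (k - 1) = L (k - 1) - n * (L (k - 2) - L (k - 1)) := by
    unfold pull; rw [if_neg (by omega), if_pos rfl]
  refine ⟨by rw [e1]; linarith, fun i hi => ?_⟩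
  rw [e1]
  unfold pull
  split_ifs with h5 h6
  · linarith
  · exact le_rfl
  · have := h2 (i - 1) (by omega)
    linarith

lemma good_pull {k : ℕ} (hk : 2 ≤ k) (n : ℕ) {L : ℕ → ℤ} (h : InvL k L) {w : Seq}
    (hw0 : w 0 = k - 1) (hg : Good w L) : Good (lamSub k n w) (pull k n L) := by
  obtain ⟨C, hC⟩ := hg
  refine ⟨C + (n + 1) * (L (k - 2) - L (k - 1)), fun x hx => ?_⟩
  obtain ⟨u, e, hu, hp⟩ := core hk n w hw0 x hx
  have := wsum_perm (pull k n L) hp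
  rw [wsum_append, wsum_append, wsum_replicate, wsum_replicate,
    wsum_pull hk n L u (fun a ha => by have := adm_le hu a ha; omega)] at this
  have h0 : pull k n L 0 = L (k - 2) - L (k - 1) := by simp [pull]
  rw [h0] at this
  have h3 := h.2 (k - 2) (by omega)
  have h4 : 0 ≤ (e : ℤ) * (L (k - 2) - L (k - 1)) := by
    apply mul_nonneg <;> omega
  have h5 := hC u hu
  push_cast at this
  linarith

/-! ### Prependable words and concatenation -/

lemma prep_app_le {w : Seq} {y : List ℕ} (h : Prep w y) : seqLe (app y w) w := by
  cases y with
  | nil => exact seqLe_refl _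
  | cons a y => exact h.1

lemma prep_append {w : Seq} {x y : List ℕ} (hx : Prep w x) (hy : Prep w y) : Prep w (x ++ y) := by
  induction x with
  | nil => exact hy
  | cons a x ih =>
    refine ⟨?_, ih hx.2⟩
    have := app_append (a :: x) y w
    rw [List.cons_append] at this
    show seqLe (app (a :: (x ++ y)) w) w
    rw [this]
    exact seqLe_trans (seqLe_app _ (prep_app_le hy)) hx.1

lemma prep_low {w : Seq} {a : ℕ} {x : List ℕ} (ha : a < w 0) (hx : Prep w x) :
    Prep w (a :: x) := ⟨seqLe_of_zero ha, hx⟩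

lemma prep_zeros {w : Seq} (hw : 0 < w 0) (e : ℕ) : Prep w (List.replicate e 0) := by
  induction e with
  | zero => trivial
  | succ e ih => exact prep_low hw ih

lemma prep_drop {w : Seq} {x : List ℕ} (hx : Prep w x) (r : ℕ) : Prep w (x.drop r) := by
  induction r generalizing x with
  | zero => exact hx
  | succ r ih =>
    cases x with
    | nil => trivial
    | cons a x => exact ih hx.2

lemma lamWord_form (k n i : ℕ) : ∃ h j, lamWord k n i = h :: List.replicate j 0 := by
  unfold lamWord
  split_ifs
  · exact ⟨_, 0, rfl⟩
  · exact ⟨_, _, rfl⟩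
  · exact ⟨_, _, rfl⟩

lemma lamSub_zero_eq {k : ℕ} (hk : 2 ≤ k) (n : ℕ) {w : Seq} (hw : k - 2 ≤ w 0) :
    lamSub k n w 0 = k - 1 := by
  rw [lamSub_zero hk, if_neg (by omega)]

lemma prep_lam {k : ℕ} (hk : 2 ≤ k) (n : ℕ) {w : Seq} (hw : InSigma k w) (hw0 : k - 2 ≤ w 0)
    {y : List ℕ} (hy : Prep w y) : Prep (lamSub k n w) (lamL k n y) := by
  have h0 := lamSub_zero_eq hk n hw0
  induction y with
  | nil => trivial
  | cons a y ih =>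
    have h1 := lamSub_le hk n hw hy.1
    rw [lamSub_app] at h1
    obtain ⟨h, j, hh⟩ := lamWord_form k n a
    rw [lamL_cons, hh] at h1 ⊢
    exact ⟨h1, prep_append (prep_zeros (by omega) j) (ih hy.2)⟩

/-- Partial concatenations. -/
def Zc (Y : ℕ → List ℕ) : ℕ → List ℕ
  | 0 => []
  | J + 1 => Zc Y J ++ Y J

/-- Infinite concatenation. -/
def conc (Y : ℕ → List ℕ) : Seq := fun t => (Zc Y (t + 1)).getD t 0

lemma Zc_length {Y : ℕ → List ℕ} (hY : ∀ j, Y j ≠ []) (J : ℕ) : J ≤ (Zc Y J).length := by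
  induction J with
  | zero => simp
  | succ J ih =>
    have := List.length_pos_iff.2 (hY J)
    simp only [Zc, List.length_append]; omega

lemma Zc_stable (Y : ℕ → List ℕ) (J d t : ℕ) (h : t < (Zc Y J).length) :
    (Zc Y (J + d)).getD t 0 = (Zc Y J).getD t 0 := by
  have : (Zc Y J).length ≤ (Zc Y (J + d)).length ∧
      (Zc Y (J + d)).getD t 0 = (Zc Y J).getD t 0 := by
    induction d with
    | zero => exact ⟨le_rfl, rfl⟩
    | succ d ih =>
      have e : Zc Y (J + (d + 1)) = Zc Y (J + d) ++ Y (J + d) := rfl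
      rw [e]
      refine ⟨by rw [List.length_append]; omega, ?_⟩
      rw [List.getD_append _ _ _ _ (by omega)]
      exact ih.2
  exact this.2

lemma conc_eq {Y : ℕ → List ℕ} (hY : ∀ j, Y j ≠ []) (J t : ℕ) (h : t < (Zc Y J).length) :
    conc Y t = (Zc Y J).getD t 0 := by
  unfold conc
  rcases le_total J (t + 1) with h1 | h1
  · obtain ⟨d, hd⟩ := Nat.exists_eq_add_of_le h1
    rw [hd]; exact Zc_stable Y J d t h
  · obtain ⟨d, hd⟩ := Nat.exists_eq_add_of_le h1
    rw [hd]
    have := Zc_length hY (t + 1)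
    exact (Zc_stable Y (t + 1) d t (by omega)).symm

lemma Zc_mem {Y : ℕ → List ℕ} {P : ℕ → Prop} (hY : ∀ j, ∀ a ∈ Y j, P a) (J : ℕ) :
    ∀ a ∈ Zc Y J, P a := by
  induction J with
  | zero => intro a ha; simp [Zc] at ha
  | succ J ih =>
    intro a ha
    rcases List.mem_append.1 ha with h | h
    · exact ih a h
    · exact hY J a h

lemma Zc_prep {w : Seq} {Y : ℕ → List ℕ} (hY : ∀ j, Prep w (Y j)) (J : ℕ) : Prep w (Zc Y J) := by
  induction J with
  | zero => trivial
  | succ J ih => exact prep_append ih (hY J)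

lemma shift_iter (r : ℕ) (s : Seq) (i : ℕ) : (shift^[r] s) i = s (i + r) := by
  induction r generalizing s with
  | zero => rfl
  | succ r ih => rw [Function.iterate_succ_apply, ih, shift_apply, Nat.add_assoc]

lemma shift_iter_app (r : ℕ) (x : List ℕ) (s : Seq) (h : r ≤ x.length) :
    shift^[r] (app x s) = app (x.drop r) s := by
  induction r generalizing x with
  | zero => rfl
  | succ r ih =>
    cases x with
    | nil => simp at h
    | cons a x =>
      rw [Function.iterate_succ_apply, app_cons, shift_scons, List.drop_succ_cons]
      exact ih x (by simpa using h)

lemma conc_mem {k : ℕ} {w : Seq} {Y : ℕ → List ℕ} (hY : ∀ j, Y j ≠ [])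
    (hlt : ∀ j, ∀ a ∈ Y j, a < k) (hP : ∀ j, Prep w (Y j)) : conc Y ∈ Xset k w := by
  constructor
  · intro r
    have h := Zc_length hY (r + 1)
    have h' : r < (Zc Y (r + 1)).length := by omega
    rw [conc_eq hY (r + 1) r h', List.getD_eq_getElem _ _ h']
    exact Zc_mem hlt _ _ (List.getElem_mem h')
  · intro r
    apply seqLe_of_agree
    intro t
    have hlen := Zc_length hY (r + t)
    refine ⟨shift^[r] (app (Zc Y (r + t)) w), ?_, ?_⟩
    · rw [shift_iter_app _ _ _ (by omega)]
      exact prep_app_le (prep_drop (Zc_prep hP _) r)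
    · intro s hs
      rw [shift_iter, shift_iter, conc_eq hY (r + t) (s + r) (by omega), app_apply,
        if_pos (by omega)]

lemma digitCount_eq (v : Seq) (i t : ℕ) : digitCount v i t = (pre v t).count i := by
  induction t with
  | zero => simp [digitCount, pre]
  | succ t ih =>
    have h1 : pre v (t + 1) = pre v t ++ [v t] := by
      simp [pre, List.range_succ]
    rw [h1, List.count_append, ← ih]
    unfold digitCount
    rw [Finset.range_add_one, Finset.filter_insert]
    by_cases h : v t = i
    · rw [if_pos h, Finset.card_insert_of_notMem (by simp), h]; simp
    · rw [if_neg h, List.count_singleton]; simp [h]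

lemma pre_length (v : Seq) (t : ℕ) : (pre v t).length = t := by simp [pre]

lemma pre_add (v : Seq) (s t : ℕ) : pre v (s + t) = pre v s ++ pre (shift^[s] v) t := by
  apply List.ext_getElem
  · simp [pre]
  · intro i h1 h2
    simp only [pre, List.getElem_append, List.getElem_map, List.getElem_range, List.length_map,
      List.length_range]
    split_ifs with h
    · rfl
    · rw [shift_iter]; congr 1; omega

lemma conc_pre {Y : ℕ → List ℕ} (hY : ∀ j, Y j ≠ []) (J : ℕ) :
    pre (conc Y) (Zc Y J).length = Zc Y J := by
  apply List.ext_getElem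
  · simp [pre]
  · intro i h1 h2
    simp only [pre, List.getElem_map, List.getElem_range]
    rw [conc_eq hY J i h2, List.getD_eq_getElem _ _ h2]

lemma digitCount_mono (v : Seq) (i : ℕ) {s t : ℕ} (h : s ≤ t) :
    digitCount v i s ≤ digitCount v i t := by
  obtain ⟨d, rfl⟩ := Nat.exists_eq_add_of_le h
  rw [digitCount_eq, digitCount_eq, pre_add, List.count_append]
  omega

lemma conc_freq {Y : ℕ → List ℕ} (hY : ∀ j, Y j ≠ []) (i : ℕ) (a : ℝ)
    (h1 : Tendsto (fun J => (((Zc Y J).count i : ℕ) : ℝ) / ((Zc Y J).length : ℝ)) atTop (𝓝 a))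
    (h2 : Tendsto (fun J => ((Y J).length : ℝ) / ((Zc Y J).length : ℝ)) atTop (𝓝 0)) :
    Tendsto (fun t => (digitCount (conc Y) i t : ℝ) / (t : ℝ)) atTop (𝓝 a) := by
  set jj : ℕ → ℕ := fun t => Nat.findGreatest (fun J => (Zc Y J).length ≤ t) t with hjj
  have hj1 : ∀ t, (Zc Y (jj t)).length ≤ t := fun t =>
    Nat.findGreatest_spec (P := fun J => (Zc Y J).length ≤ t) (Nat.zero_le t) (by simp [Zc])
  have hj2 : ∀ t, t < (Zc Y (jj t + 1)).length := by
    intro t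
    by_contra hc
    push Not at hc
    have h3 := Zc_length hY (jj t + 1)
    have := Nat.le_findGreatest (n := t) (P := fun J => (Zc Y J).length ≤ t) (by omega) hc
    have : jj t + 1 ≤ jj t := this
    omega
  have hj3 : Tendsto jj atTop atTop := by
    rw [tendsto_atTop_atTop]
    intro b
    refine ⟨(Zc Y b).length, fun t ht => ?_⟩
    have h3 := Zc_length hY b
    exact Nat.le_findGreatest (P := fun J => (Zc Y J).length ≤ t) (by omega) ht
  have hb : Tendsto (fun t => |(((Zc Y (jj t)).count i : ℕ) : ℝ) / ((Zc Y (jj t)).length : ℝ) - a|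
      + (1 + |a|) * (((Y (jj t)).length : ℝ) / ((Zc Y (jj t)).length : ℝ))) atTop (𝓝 0) := by
    have e1 : Tendsto (fun J => |(((Zc Y J).count i : ℕ) : ℝ) / ((Zc Y J).length : ℝ) - a|
      + (1 + |a|) * (((Y J).length : ℝ) / ((Zc Y J).length : ℝ))) atTop (𝓝 0) := by
      have := ((h1.sub_const a).abs).add (h2.const_mul (1 + |a|))
      simpa using this
    exact e1.comp hj3
  rw [tendsto_iff_norm_sub_tendsto_zero]
  refine squeeze_zero' (Eventually.of_forall fun t => norm_nonneg _) ?_ hb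
  filter_upwards [hj3.eventually_ge_atTop 1] with t ht
  set J := jj t
  have hN := hj1 t
  have hM := hj2 t
  have hNpos : 1 ≤ (Zc Y J).length := le_trans ht (Zc_length hY J)
  have hZ : (Zc Y (J + 1)) = Zc Y J ++ Y J := rfl
  have c1 : (Zc Y J).count i ≤ digitCount (conc Y) i t := by
    have := digitCount_mono (conc Y) i hN
    rwa [digitCount_eq, conc_pre hY] at this
  have c2 : digitCount (conc Y) i t ≤ (Zc Y J).count i + (Y J).length := by
    have := digitCount_mono (conc Y) i hM.le
    rw [digitCount_eq _ _ (Zc Y (J + 1)).length, conc_pre hY, hZ, List.count_append] at this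
    have h3 : (Y J).count i ≤ (Y J).length := List.count_le_length
    omega
  rw [hZ, List.length_append] at hM
  rw [Real.norm_eq_abs]
  have c1' : (((Zc Y J).count i : ℕ) : ℝ) ≤ digitCount (conc Y) i t := by exact_mod_cast c1
  have c2' : (digitCount (conc Y) i t : ℝ) ≤ ((Zc Y J).count i : ℕ) + ((Y J).length : ℝ) := by
    exact_mod_cast c2
  have hNp : ((Zc Y J).length : ℝ) ≤ t := by exact_mod_cast hN
  have hM' : (t : ℝ) ≤ ((Zc Y J).length : ℝ) + ((Y J).length : ℝ) := by exact_mod_cast hM.le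
  have hp : (0 : ℝ) < ((Zc Y J).length : ℝ) := by exact_mod_cast hNpos
  generalize (((Zc Y J).count i : ℕ) : ℝ) = c at *
  generalize (digitCount (conc Y) i t : ℝ) = d at *
  generalize ((Zc Y J).length : ℝ) = N at *
  generalize ((Y J).length : ℝ) = M at *
  generalize (t : ℝ) = τ at *
  have hτ : 0 < τ := lt_of_lt_of_le hp hNp
  have e1 : d / τ - a = (d - a * τ) / τ := by field_simp
  have e2 : c / N - a = (c - a * N) / N := by field_simp
  rw [e1, e2, abs_div, abs_div, abs_of_pos hτ, abs_of_pos hp, mul_div_assoc', ← add_div]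
  have h5 : |d - a * τ| ≤ |c - a * N| + (1 + |a|) * M := by
    have : d - a * τ = (c - a * N) + ((d - c) - a * (τ - N)) := by ring
    rw [this]
    refine (abs_add_le _ _).trans ?_
    have h6 : |(d - c) - a * (τ - N)| ≤ |d - c| + |a * (τ - N)| := abs_sub _ _
    have h7 : |d - c| ≤ M := by rw [abs_le]; constructor <;> linarith
    have h8 : |a * (τ - N)| ≤ |a| * M := by
      rw [abs_mul, abs_of_nonneg (by linarith : 0 ≤ τ - N)]
      exact mul_le_mul_of_nonneg_left (by linarith) (abs_nonneg _)
    linarith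
  have h9 : 0 ≤ |c - a * N| + (1 + |a|) * M := le_trans (abs_nonneg _) h5
  exact div_le_div₀ h9 h5 hp hNp

/-! ### Digit frequency sets -/

lemma sum_count {k : ℕ} (x : List ℕ) (hx : ∀ a ∈ x, a < k) :
    ∑ i ∈ Finset.range k, x.count i = x.length := by
  induction x with
  | nil => simp
  | cons a x ih =>
    have ha : a < k := hx a (by simp)
    simp only [List.count_cons, Finset.sum_add_distrib, List.length_cons]
    rw [ih (fun b hb => hx b (by simp [hb]))]
    simp [ha]

lemma wsum_count {k : ℕ} (L : ℕ → ℤ) (x : List ℕ) (hx : ∀ a ∈ x, a < k) :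
    wsum L x = ∑ i ∈ Finset.range k, L i * x.count i := by
  induction x with
  | nil => simp [wsum]
  | cons a x ih =>
    have ha : a < k := hx a (by simp)
    rw [wsum_cons, ih (fun b hb => hx b (by simp [hb]))]
    simp only [List.count_cons, Nat.cast_add, mul_add, Finset.sum_add_distrib]
    simp [ha, add_comm]

lemma adm_pre {k : ℕ} {w v : Seq} (hv : v ∈ Xset k w) (r t : ℕ) :
    Adm w (pre (shift^[r] v) t) := by
  induction t generalizing r with
  | zero => trivial
  | succ t ih =>
    have h1 := le_pre_of_seqLe (hv.2 r) (t + 1)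
    rw [pre_succ] at h1 ⊢
    refine ⟨h1, ?_⟩
    have := ih (r + 1)
    rwa [Function.iterate_succ_apply'] at this

lemma pre_lt {k : ℕ} {v : Seq} (hv : InSigma k v) (t : ℕ) : ∀ a ∈ pre v t, a < k := by
  intro a ha
  obtain ⟨i, _, rfl⟩ := List.mem_map.1 ha
  exact hv i

/-- Linear inequality satisfied by the digit frequencies. -/
lemma good_DF {k : ℕ} {w : Seq} {L : ℕ → ℤ} (hg : Good w L) {α : E k} (hα : α ∈ DFw k w) :
    0 ≤ ∑ i ∈ Finset.range k, (L i : ℝ) * proj α i := by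
  obtain ⟨C, hC⟩ := hg
  obtain ⟨_, v, hv, hf⟩ := hα
  have h1 : Tendsto (fun t : ℕ => ∑ i ∈ Finset.range k,
      (L i : ℝ) * ((digitCount v i t : ℝ) / (t : ℝ))) atTop
      (𝓝 (∑ i ∈ Finset.range k, (L i : ℝ) * proj α i)) :=
    tendsto_finsetSum _ fun i hi => (hf i (Finset.mem_range.1 hi)).const_mul _
  have h2 : Tendsto (fun t : ℕ => -(C : ℝ) / (t : ℝ)) atTop (𝓝 0) :=
    tendsto_const_div_atTop_nhds_zero_nat _
  refine le_of_tendsto_of_tendsto' h2 h1 fun t => ?_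
  have h3 := hC _ (adm_pre hv 0 t)
  simp only [Function.iterate_zero, id] at h3
  rw [wsum_count L _ (pre_lt hv.1 t)] at h3
  have h4 : -(C : ℝ) ≤ ∑ i ∈ Finset.range k, (L i : ℝ) * (digitCount v i t : ℝ) := by
    simp only [digitCount_eq]
    exact_mod_cast h3
  have h5 : ∑ i ∈ Finset.range k, (L i : ℝ) * ((digitCount v i t : ℝ) / (t : ℝ))
      = (∑ i ∈ Finset.range k, (L i : ℝ) * (digitCount v i t : ℝ)) / t := by
    rw [Finset.sum_div]
    exact Finset.sum_congr rfl fun i _ => by rw [mul_div_assoc]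
  rw [h5]
  exact div_le_div_of_nonneg_right h4 (Nat.cast_nonneg t)

lemma DF_mono {k : ℕ} {w w' : Seq} (h : seqLe w w') : DFw k w ⊆ DFw k w' := by
  rintro α ⟨h1, v, hv, hf⟩
  exact ⟨h1, v, ⟨hv.1, fun r => seqLe_trans (hv.2 r) h⟩, hf⟩

/-- Frequency vector of a word. -/
noncomputable def wfreq (k : ℕ) (y : List ℕ) : E k :=
  WithLp.toLp 2 fun i : Fin k => (y.count (i : ℕ) : ℝ) / (y.length : ℝ)

lemma proj_wfreq {k : ℕ} (y : List ℕ) {i : ℕ} (hi : i < k) :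
    proj (wfreq k y) i = (y.count i : ℝ) / (y.length : ℝ) := by
  simp [proj, hi, wfreq]

lemma Zc_const (y : List ℕ) (J : ℕ) :
    (Zc (fun _ => y) J).length = J * y.length ∧
      ∀ i, (Zc (fun _ => y) J).count i = J * y.count i := by
  induction J with
  | zero => simp [Zc]
  | succ J ih =>
    simp only [Zc, List.length_append, List.count_append, ih.1, ih.2]
    constructor
    · ring
    · intro i; ring

lemma wfreq_mem {k : ℕ} {w : Seq} {y : List ℕ} (hne : y ≠ []) (hlt : ∀ a ∈ y, a < k)
    (hP : Prep w y) : wfreq k y ∈ DFw k w := by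
  have hl : 0 < y.length := List.length_pos_iff.2 hne
  have hlp : (0 : ℝ) < y.length := by exact_mod_cast hl
  refine ⟨⟨fun i => ?_, ?_⟩, conc (fun _ => y), conc_mem (fun _ => hne) (fun _ => hlt)
    (fun _ => hP), fun i hi => ?_⟩
  · simp only [wfreq]; positivity
  · simp only [wfreq]
    rw [← Finset.sum_div, div_eq_one_iff_eq hlp.ne',
      Fin.sum_univ_eq_sum_range (fun i => (y.count i : ℝ)) k]
    exact_mod_cast sum_count y hlt
  · rw [proj_wfreq y hi]
    apply conc_freq (fun _ => hne)
    · apply tendsto_const_nhds.congr'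
      filter_upwards [eventually_ge_atTop 1] with J hJ
      have hJ' : (J : ℝ) ≠ 0 := by positivity
      rw [(Zc_const y J).1, (Zc_const y J).2]
      push_cast
      rw [mul_div_mul_left _ _ hJ']
    · have h2 : Tendsto (fun t : ℕ => (1 : ℝ) / (t : ℝ)) atTop (𝓝 0) :=
        tendsto_const_div_atTop_nhds_zero_nat _
      apply h2.congr
      intro J
      rw [(Zc_const y J).1]
      push_cast
      rw [div_mul_eq_div_div_swap, div_self (ne_of_gt hlp)]

/-- Transfer of admissible words of `w1` to prependable words of `w2`, up to bounded error. -/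
def Trel (k : ℕ) (w1 w2 : Seq) : Prop :=
  ∃ C : ℕ, ∀ x, Adm w1 x → ∃ y, Prep w2 y ∧ (∀ a ∈ y, a < k) ∧
    ∀ i, y.count i ≤ x.count i + C ∧ x.count i ≤ y.count i + C

/-- Triangular numbers. -/
def tri : ℕ → ℕ
  | 0 => 0
  | J + 1 => tri J + (J + 1)

lemma tri_eq (J : ℕ) : (tri J : ℝ) = J * (J + 1) / 2 := by
  induction J with
  | zero => simp [tri]
  | succ J ih =>
    simp only [tri]; push_cast; rw [ih]; ring

lemma tri_tendsto : Tendsto tri atTop atTop := by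
  apply tendsto_atTop_mono (f := fun n => n) _ tendsto_id
  intro n
  cases n with
  | zero => exact le_rfl
  | succ n => simp only [tri]; omega

lemma div_tri (c : ℝ) : Tendsto (fun J : ℕ => c * ((J : ℝ) / (tri J : ℝ))) atTop (𝓝 0) := by
  have h2 : Tendsto (fun t : ℕ => (2 : ℝ) / ((t + 1 : ℕ) : ℝ)) atTop (𝓝 0) :=
    (tendsto_const_div_atTop_nhds_zero_nat 2).comp (tendsto_add_atTop_nat 1)
  have h3 := h2.const_mul c
  rw [mul_zero] at h3
  apply h3.congr'
  filter_upwards [eventually_ge_atTop 1] with J hJ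
  have hJ' : (J : ℝ) ≠ 0 := by positivity
  have hJ2 : (J : ℝ) + 1 ≠ 0 := by positivity
  rw [tri_eq]
  push_cast
  field_simp

lemma tendsto_near {f g : ℕ → ℝ} {a c : ℝ}
    (hf : Tendsto (fun J => f J / (tri J : ℝ)) atTop (𝓝 a))
    (h : ∀ J : ℕ, |g J - f J| ≤ c * J) :
    Tendsto (fun J => g J / (tri J : ℝ)) atTop (𝓝 a) := by
  have h1 : Tendsto (fun J => (g J - f J) / (tri J : ℝ)) atTop (𝓝 0) := by
    apply squeeze_zero_norm _ (div_tri c)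
    intro J
    rw [Real.norm_eq_abs, abs_div, Nat.abs_cast, mul_div_assoc']
    exact div_le_div_of_nonneg_right (h J) (Nat.cast_nonneg _)
  have := h1.add hf
  rw [zero_add] at this
  apply this.congr
  intro J
  rw [← add_div, sub_add_cancel]

lemma trel_DF {k : ℕ} (hk : 2 ≤ k) {w1 w2 : Seq} (h : Trel k w1 w2) (hw2 : w2 0 = k - 1) :
    DFw k w1 ⊆ DFw k w2 := by
  obtain ⟨C, hC⟩ := h
  rintro α ⟨hα, v, hv, hf⟩
  have hx : ∀ j, Adm w1 (pre (shift^[tri j] v) (j + 1)) := fun j => adm_pre hv _ _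
  choose y hy1 hy2 hy3 using fun j => hC _ (hx j)
  set Y : ℕ → List ℕ := fun j => 0 :: y j with hY
  have hYne : ∀ j, Y j ≠ [] := fun j => by simp [hY]
  have hYlt : ∀ j, ∀ a ∈ Y j, a < k := by
    intro j a ha
    rcases List.mem_cons.1 ha with rfl | ha
    · omega
    · exact hy2 j a ha
  have hYP : ∀ j, Prep w2 (Y j) := fun j => prep_low (by omega) (hy1 j)
  have hYc : ∀ j i, (Y j).count i ≤ (pre (shift^[tri j] v) (j + 1)).count i + (C + 1) ∧
      (pre (shift^[tri j] v) (j + 1)).count i ≤ (Y j).count i + (C + 1) := by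
    intro j i
    have := hy3 j i
    simp only [hY, List.count_cons]
    split_ifs <;> omega
  have hZc : ∀ J i, (Zc Y J).count i ≤ (pre v (tri J)).count i + (C + 1) * J ∧
      (pre v (tri J)).count i ≤ (Zc Y J).count i + (C + 1) * J := by
    intro J i
    induction J with
    | zero => simp [Zc, tri, pre]
    | succ J ih =>
      have := hYc J i
      rw [show tri (J + 1) = tri J + (J + 1) from rfl, pre_add, show Zc Y (J + 1) = Zc Y J ++ Y J from rfl,
        List.count_append, List.count_append, Nat.mul_succ]
      omega
  have hshift : ∀ r, InSigma k (shift^[r] v) := fun r i => by rw [shift_iter]; exact hv.1 _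
  have hlen : ∀ (x z : List ℕ) (D : ℕ), (∀ a ∈ x, a < k) → (∀ a ∈ z, a < k) →
      (∀ i, x.count i ≤ z.count i + D) → x.length ≤ z.length + k * D := by
    intro x z D hx hz hD
    rw [← sum_count x hx, ← sum_count z hz]
    calc ∑ i ∈ Finset.range k, x.count i ≤ ∑ i ∈ Finset.range k, (z.count i + D) :=
          Finset.sum_le_sum fun i _ => hD i
      _ = _ := by rw [Finset.sum_add_distrib]; simp
  have hYl : ∀ J, (Y J).length ≤ (J + 1) + k * (C + 1) := by
    intro J
    have := hlen (Y J) (pre (shift^[tri J] v) (J + 1)) (C + 1) (hYlt J) (pre_lt (hshift _) _)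
      (fun i => (hYc J i).1)
    rwa [pre_length] at this
  have hZl : ∀ J, (Zc Y J).length ≤ tri J + k * ((C + 1) * J) ∧
      tri J ≤ (Zc Y J).length + k * ((C + 1) * J) := by
    intro J
    have h1 := hlen (Zc Y J) (pre v (tri J)) ((C + 1) * J) (Zc_mem hYlt J) (pre_lt hv.1 _)
      (fun i => (hZc J i).1)
    have h2 := hlen (pre v (tri J)) (Zc Y J) ((C + 1) * J) (pre_lt hv.1 _) (Zc_mem hYlt J)
      (fun i => (hZc J i).2)
    rw [pre_length] at h1 h2
    exact ⟨h1, h2⟩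
  have hten1 : Tendsto (fun J => ((Zc Y J).length : ℝ) / (tri J : ℝ)) atTop (𝓝 1) := by
    apply tendsto_near (f := fun J => (tri J : ℝ)) (c := k * (C + 1))
    · apply tendsto_const_nhds.congr'
      filter_upwards [tri_tendsto.eventually_ge_atTop 1] with J hJ
      rw [div_self]
      positivity
    · intro J
      have h1 : ((Zc Y J).length : ℝ) ≤ tri J + k * ((C + 1) * J) := by exact_mod_cast (hZl J).1
      have h2 : (tri J : ℝ) ≤ (Zc Y J).length + k * ((C + 1) * J) := by exact_mod_cast (hZl J).2
      rw [abs_le]; constructor <;> nlinarith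
  have htri_ne : ∀ᶠ J in atTop, (tri J : ℝ) ≠ 0 := by
    filter_upwards [tri_tendsto.eventually_ge_atTop 1] with J hJ
    positivity
  refine ⟨hα, conc Y, conc_mem hYne hYlt hYP, fun i hi => ?_⟩
  apply conc_freq hYne
  · have h1 : Tendsto (fun J => (((Zc Y J).count i : ℕ) : ℝ) / (tri J : ℝ)) atTop
        (𝓝 (proj α i)) := by
      apply tendsto_near (f := fun J => (digitCount v i (tri J) : ℝ)) (c := C + 1)
      · exact (hf i hi).comp tri_tendsto
      · intro J
        rw [digitCount_eq]
        have h1 : ((Zc Y J).count i : ℝ) ≤ (pre v (tri J)).count i + (C + 1) * J := by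
          exact_mod_cast (hZc J i).1
        have h2 : ((pre v (tri J)).count i : ℝ) ≤ (Zc Y J).count i + (C + 1) * J := by
          exact_mod_cast (hZc J i).2
        rw [abs_le]; constructor <;> linarith
    have h2 := h1.div hten1 one_ne_zero
    rw [div_one] at h2
    apply h2.congr'
    filter_upwards [htri_ne] with J hJ
    exact div_div_div_cancel_right₀ hJ _ _
  · have h1 : Tendsto (fun J => ((Y J).length : ℝ) / (tri J : ℝ)) atTop (𝓝 0) := by
      refine squeeze_zero' (Eventually.of_forall fun J => by positivity) ?_
        (div_tri (2 + k * (C + 1)))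
      filter_upwards [eventually_ge_atTop 1] with J hJ
      rw [mul_div_assoc']
      apply div_le_div_of_nonneg_right _ (Nat.cast_nonneg _)
      have h1 : ((Y J).length : ℝ) ≤ (J + 1) + k * (C + 1) := by exact_mod_cast hYl J
      have h2 : (1 : ℝ) ≤ J := by exact_mod_cast hJ
      have h3 : (0 : ℝ) ≤ k * (C + 1) := by positivity
      nlinarith
    have h2 := h1.div hten1 one_ne_zero
    rw [div_one] at h2
    apply h2.congr'
    filter_upwards [htri_ne] with J hJ
    exact div_div_div_cancel_right₀ hJ _ _

/-! ### The approximation relation is preserved by the substitutions -/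

lemma count_lamL (k n : ℕ) (u : List ℕ) (hu : ∀ a ∈ u, a < k) (i : ℕ) :
    (lamL k n u).count i = ∑ j ∈ Finset.range k, u.count j * (lamWord k n j).count i := by
  induction u with
  | nil => simp [lamL]
  | cons a u ih =>
    have ha : a < k := hu a (by simp)
    rw [lamL_cons, List.count_append, ih fun b hb => hu b (by simp [hb])]
    simp only [List.count_cons, add_mul, Finset.sum_add_distrib]
    rw [add_comm]
    congr 1
    rw [Finset.sum_eq_single a]
    · simp
    · intro b _ hb
      have : ¬ (a = b) := fun h => hb h.symm
      simp [this]
    · intro h; simp [ha] at h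

lemma count_lamWord_le (k n j i : ℕ) : (lamWord k n j).count i ≤ n + 2 := by
  refine List.count_le_length.trans ?_
  unfold lamWord
  split_ifs <;> simp

lemma count_lamL_le {k n : ℕ} {u v : List ℕ} (hu : ∀ a ∈ u, a < k) (hv : ∀ a ∈ v, a < k) {C : ℕ}
    (h : ∀ i, u.count i ≤ v.count i + C) (i : ℕ) :
    (lamL k n u).count i ≤ (lamL k n v).count i + k * (C * (n + 2)) := by
  rw [count_lamL k n u hu, count_lamL k n v hv]
  calc ∑ j ∈ Finset.range k, u.count j * (lamWord k n j).count i
      ≤ ∑ j ∈ Finset.range k, (v.count j * (lamWord k n j).count i + C * (n + 2)) := by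
        apply Finset.sum_le_sum
        intro j _
        calc u.count j * (lamWord k n j).count i
            ≤ (v.count j + C) * (lamWord k n j).count i := Nat.mul_le_mul_right _ (h j)
          _ = v.count j * (lamWord k n j).count i + C * (lamWord k n j).count i := add_mul _ _ _
          _ ≤ _ := Nat.add_le_add_left (Nat.mul_le_mul_left _ (count_lamWord_le _ _ _ _)) _
    _ = _ := by rw [Finset.sum_add_distrib]; simp

lemma adm_lt {k : ℕ} (hk : 2 ≤ k) {w : Seq} (hw0 : w 0 = k - 1) {x : List ℕ} (h : Adm w x) :
    ∀ a ∈ x, a < k := by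
  induction x with
  | nil => simp
  | cons b x ih =>
    intro a ha
    rcases List.mem_cons.1 ha with rfl | ha
    · rcases h.1 with h1 | h1 <;> omega
    · exact ih h.2 a ha

lemma trel_step {k : ℕ} (hk : 2 ≤ k) (n : ℕ) {w1 w2 : Seq} (h : Trel k w1 w2)
    (hw1 : w1 0 = k - 1) (hs : InSigma k w2) (hw2 : k - 2 ≤ w2 0) :
    Trel k (lamSub k n w1) (lamSub k n w2) := by
  obtain ⟨C, hC⟩ := h
  refine ⟨k * (C * (n + 2)) + (n + 1), fun x hx => ?_⟩
  obtain ⟨u, e, hu, hp⟩ := core hk n w1 hw1 x hx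
  obtain ⟨y, hy1, hy2, hy3⟩ := hC u hu
  have hul := adm_lt hk hw1 hu
  have h0 := lamSub_zero_eq hk n hw2
  refine ⟨List.replicate e 0 ++ lamL k n y, prep_append (prep_zeros (by omega) e)
    (prep_lam hk n hs hw2 hy1), ?_, fun i => ?_⟩
  · intro a ha
    rcases List.mem_append.1 ha with ha | ha
    · rw [List.eq_of_mem_replicate ha]; omega
    · exact lamL_lt hk n _ a ha
  · have h1 := count_lamL_le (n := n) hy2 hul (fun i => (hy3 i).1) i
    have h2 := count_lamL_le (n := n) hul hy2 (fun i => (hy3 i).2) i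
    have h3 := hp.count_eq i
    have h4 : (List.replicate (n + 1) 0).count i ≤ n + 1 :=
      List.count_le_length.trans (by simp)
    rw [List.count_append, List.count_append] at h3
    rw [List.count_append]
    omega

lemma prep_const {c : ℕ} {y : List ℕ} (h : ∀ a ∈ y, a ≤ c) : Prep (fun _ => c) y := by
  induction y with
  | nil => trivial
  | cons a y ih =>
    have hy := ih fun b hb => h b (by simp [hb])
    refine ⟨?_, hy⟩
    rcases (h a (by simp)).lt_or_eq with h1 | h1
    · exact seqLe_of_zero h1
    · have h2 := seqLe_app [c] (prep_app_le hy)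
      subst h1
      have h3 : app [a] (fun _ => a) = fun _ => a := by
        funext i; cases i <;> rfl
      rw [h3] at h2
      exact h2

lemma base_zero {k : ℕ} {x : List ℕ} (h : le x (shift (baseSeq k))) : ∀ a ∈ x, a = 0 := by
  have hs : shift (baseSeq k) = fun _ => 0 := by funext i; simp [baseSeq]
  rw [hs] at h
  induction x with
  | nil => simp
  | cons a x ih =>
    rcases h with h | h
    · simp at h
    · intro b hb
      rcases List.mem_cons.1 hb with rfl | hb
      · exact h.1
      · exact ih h.2 b hb

lemma trel_base {k : ℕ} (hk : 2 ≤ k) : Trel k (baseSeq k) (fun _ => k - 2) := by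
  refine ⟨1, fun x hx => ?_⟩
  have hlt := adm_lt hk (w := baseSeq k) (by simp [baseSeq]) hx
  refine ⟨x.map (fun a => min a (k - 2)), prep_const ?_, ?_, fun i => ?_⟩
  · intro a ha
    obtain ⟨b, _, rfl⟩ := List.mem_map.1 ha
    exact min_le_right _ _
  · intro a ha
    obtain ⟨b, _, rfl⟩ := List.mem_map.1 ha
    exact (min_le_right _ _).trans_lt (by omega)
  · induction x with
    | nil => simp
    | cons a x ih =>
      have ha : a < k := hlt a (by simp)
      rcases hx.1 with h1 | h1
      · have h1' : a < k - 1 := by simpa [baseSeq] using h1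
        have := ih hx.2 fun b hb => hlt b (by simp [hb])
        rw [List.map_cons, min_eq_left (by omega : a ≤ k - 2)]
        simp only [List.count_cons]
        omega
      · have h2 := base_zero h1.2
        have h3 : x.map (fun a => min a (k - 2)) = x := by
          conv_rhs => rw [← List.map_id x]
          apply List.map_congr_left
          intro b hb
          simp [h2 b hb]
        rw [List.map_cons, h3]
        simp only [List.count_cons]
        split_ifs <;> omega

/-! ### The sequences `S(n)` -/

lemma lex_dec_eventually (u : ℕ → Seq) (h : ∀ r, seqLe (u (r + 1)) (u r)) (m : ℕ) :
    ∃ N, ∀ r, N ≤ r → ∀ s, s < m → u r s = u N s := by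
  induction m with
  | zero => exact ⟨0, by simp⟩
  | succ m ih =>
    obtain ⟨N, hN⟩ := ih
    have hstep : ∀ r, N ≤ r → u (r + 1) m ≤ u r m := by
      intro r hr
      rcases h r with ⟨t, ht1, ht2⟩ | h1
      · rcases lt_trichotomy t m with h2 | h2 | h2
        · have := hN r hr t h2
          have := hN (r + 1) (by omega) t h2
          omega
        · subst h2; exact ht2.le
        · exact (ht1 m h2).le
      · rw [h1]
    have hanti : ∀ d r, N ≤ r → u (r + d) m ≤ u r m := by
      intro d
      induction d with
      | zero => intro r _; exact le_rfl
      | succ d ih => intro r hr; exact (hstep (r + d) (by omega)).trans (ih r hr)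
    have hex : ∃ v, ∃ r, N ≤ r ∧ u r m = v := ⟨_, N, le_rfl, rfl⟩
    obtain ⟨r0, hr0, hv⟩ := Nat.find_spec hex
    refine ⟨r0, fun r hr s hs => ?_⟩
    rcases Nat.lt_succ_iff_lt_or_eq.1 hs with h1 | h1
    · rw [hN r (by omega) s h1, hN r0 hr0 s h1]
    · subst h1
      apply le_antisymm
      · have := hanti (r - r0) r0 hr0
        rwa [Nat.add_sub_cancel' hr] at this
      · rw [hv]
        exact Nat.find_min' hex ⟨r, by omega, rfl⟩

lemma lex_dec_tendsto (u : ℕ → Seq) (h : ∀ r, seqLe (u (r + 1)) (u r)) :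
    ∃ l : Seq, Tendsto u atTop (𝓝 l) := by
  choose N hN using lex_dec_eventually u h
  refine ⟨fun s => u (N (s + 1)) s, ?_⟩
  rw [tendsto_pi_nhds]
  intro s
  apply tendsto_const_nhds.congr'
  filter_upwards [eventually_ge_atTop (N (s + 1))] with r hr
  exact (hN (s + 1) r hr s (Nat.lt_succ_self s)).symm

lemma inSigma_le_top {k : ℕ} {w : Seq} (h : InSigma k w) : seqLe w (topSeq k) := by
  by_cases he : w = topSeq k
  · exact Or.inr he
  · have hex : ∃ r, w r ≠ k - 1 := by
      by_contra hc
      push Not at hc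
      exact he (funext hc)
    left
    refine ⟨Nat.find hex, fun s hs => ?_, ?_⟩
    · have := Nat.find_min hex hs
      push Not at this
      exact this
    · have h1 := Nat.find_spec hex
      have h2 := h (Nat.find hex)
      show _ < k - 1
      omega

lemma inSigma_top {k : ℕ} (hk : 2 ≤ k) : InSigma k (topSeq k) := fun _ => by
  show k - 1 < k
  omega

lemma inSigma_base {k : ℕ} (hk : 2 ≤ k) : InSigma k (baseSeq k) := fun r => by
  unfold baseSeq; split_ifs <;> omega

lemma lamChain_le {k : ℕ} (hk : 2 ≤ k) (n : ℕ → ℕ) (r : ℕ) {v w : Seq} (hv : InSigma k v)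
    (hw : InSigma k w) (h : seqLe v w) : seqLe (lamChain k n r v) (lamChain k n r w) := by
  induction r generalizing v w with
  | zero => exact lamSub_le hk _ hw h
  | succ r ih =>
    exact ih (lamSub_inSigma hk _ _) (lamSub_inSigma hk _ _) (lamSub_le hk _ hw h)

lemma lamChain_succ (k : ℕ) (n : ℕ → ℕ) (r : ℕ) (w : Seq) :
    lamChain k n (r + 1) w = lamSub k (n 0) (lamChain k (fun s => n (s + 1)) r w) := by
  induction r generalizing w with
  | zero => rfl
  | succ r ih =>
    show lamChain k n (r + 1) _ = _
    rw [ih]; rfl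

lemma Sseq_tendsto {k : ℕ} (hk : 2 ≤ k) (n : ℕ → ℕ) :
    Tendsto (fun r => lamChain k n r (topSeq k)) atTop (𝓝 (Sseq k n)) := by
  apply tendsto_nhds_limUnder
  apply lex_dec_tendsto
  intro r
  exact lamChain_le hk n r (lamSub_inSigma hk _ _) (inSigma_top hk)
    (inSigma_le_top (lamSub_inSigma hk _ _))

lemma Sseq_ev {k : ℕ} (hk : 2 ≤ k) (n : ℕ → ℕ) (s : ℕ) :
    ∀ᶠ r in atTop, lamChain k n r (topSeq k) s = Sseq k n s := by
  have h := (tendsto_pi_nhds.1 (Sseq_tendsto hk n)) s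
  rw [nhds_discrete] at h
  exact tendsto_pure.1 h

lemma lamSub_congr (k n : ℕ) {v w : Seq} {m : ℕ} (h : ∀ s, s < m + 1 → v s = w s) :
    lamSub k n v m = lamSub k n w m := by
  unfold lamSub
  congr 2
  apply List.map_congr_left
  intro s hs
  rw [h s (List.mem_range.1 hs)]

lemma Sseq_step {k : ℕ} (hk : 2 ≤ k) (n : ℕ → ℕ) :
    Sseq k n = lamSub k (n 0) (Sseq k fun s => n (s + 1)) := by
  funext i
  have h1 : ∀ᶠ r in atTop, ∀ s ∈ Finset.range (i + 1),
      lamChain k (fun s => n (s + 1)) r (topSeq k) s = Sseq k (fun s => n (s + 1)) s := by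
    rw [Filter.eventually_all_finset]
    exact fun s _ => Sseq_ev hk _ s
  have h2 := (tendsto_add_atTop_nat 1).eventually (Sseq_ev hk n i)
  obtain ⟨r, hr1, hr2⟩ := (h1.and h2).exists
  rw [← hr2, lamChain_succ]
  exact lamSub_congr k _ fun s hs => hr1 s (Finset.mem_range.2 hs)

lemma lamSub_top0 {k : ℕ} (hk : 2 ≤ k) : lamSub k 0 (topSeq k) = topSeq k := by
  have h : ∀ i, lamSub k 0 (topSeq k) i = k - 1 := by
    intro i
    induction i with
    | zero => exact lamSub_zero_eq hk 0 (by show k - 2 ≤ k - 1; omega)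
    | succ i ih =>
      rw [lamSub_cons]
      show app (lamWord k 0 (k - 1)) (lamSub k 0 (topSeq k)) (i + 1) = _
      rw [lamWord_top hk]
      exact ih
  exact funext h

lemma Sseq_zero {k : ℕ} (hk : 2 ≤ k) : Sseq k (fun _ => 0) = topSeq k := by
  have h : ∀ r, lamChain k (fun _ => 0) r (topSeq k) = topSeq k := by
    intro r
    induction r with
    | zero => exact lamSub_top0 hk
    | succ r ih => show lamChain k _ r (lamSub k 0 (topSeq k)) = _; rw [lamSub_top0 hk, ih]
  funext s
  obtain ⟨r, hr⟩ := (Sseq_ev hk (fun _ => 0) s).exists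
  rw [← hr, h]

/-- The shift of an itinerary. -/
def tailNN (m : NN) : NN := ⟨fun r => m.1 (r + 1), fun r => m.2 (r + 1)⟩

lemma SN_top {k : ℕ} {m : NN} (h : m.1 0 = ⊤) : SN k m = baseSeq k := by
  have hex : ∃ R, m.1 R = ⊤ := ⟨0, h⟩
  have h0 : Nat.find hex = 0 := (Nat.find_eq_zero hex).2 h
  unfold SN
  rw [dif_pos hex, h0]
  rfl

lemma SN_step {k : ℕ} (hk : 2 ≤ k) {m : NN} {c : ℕ} (h : m.1 0 = c) :
    SN k m = lamSub k c (SN k (tailNN m)) := by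
  have hne : m.1 0 ≠ ⊤ := by rw [h]; exact ENat.natCast_ne_top c
  by_cases hex : ∃ R, m.1 R = ⊤
  · have hex' : ∃ R, (tailNN m).1 R = ⊤ := by
      obtain ⟨R, hR⟩ := hex
      cases R with
      | zero => exact absurd hR hne
      | succ R => exact ⟨R, hR⟩
    have hf : Nat.find hex = Nat.find hex' + 1 := Nat.find_comp_succ hex hex' hne
    unfold SN
    rw [dif_pos hex, dif_pos hex', hf, List.range_succ_eq_map, List.map_cons, List.map_map, h]
    rfl
  · have hex' : ¬ ∃ R, (tailNN m).1 R = ⊤ := fun ⟨R, hR⟩ => hex ⟨R + 1, hR⟩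
    unfold SN
    rw [dif_neg hex, dif_neg hex', Sseq_step hk]
    simp only [h]
    rfl

lemma lamSub_zero_of {k : ℕ} (hk : 2 ≤ k) (n : ℕ) {w : Seq} (h : w 0 = k - 1) :
    lamSub k n w 0 = k - 1 := lamSub_zero_eq hk n (by omega)

lemma Sseq_head {k : ℕ} (hk : 2 ≤ k) (n : ℕ → ℕ) : Sseq k n 0 = k - 1 := by
  have h : ∀ r, ∀ w : Seq, w 0 = k - 1 → lamChain k n r w 0 = k - 1 := by
    intro r
    induction r with
    | zero => exact fun w hw => lamSub_zero_of hk _ hw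
    | succ r ih => exact fun w hw => ih _ (lamSub_zero_of hk _ hw)
  obtain ⟨r, hr⟩ := (Sseq_ev hk n 0).exists
  rw [← hr]
  exact h r _ rfl

lemma Sseq_inSigma {k : ℕ} (hk : 2 ≤ k) (n : ℕ → ℕ) : InSigma k (Sseq k n) := by
  rw [Sseq_step hk]; exact lamSub_inSigma hk _ _

lemma lamList_head {k : ℕ} (hk : 2 ≤ k) (l : List ℕ) {w : Seq} (h : w 0 = k - 1)
    (hs : InSigma k w) : lamList k l w 0 = k - 1 ∧ InSigma k (lamList k l w) := by
  induction l with
  | nil => exact ⟨h, hs⟩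
  | cons a l ih => exact ⟨lamSub_zero_of hk _ ih.1, lamSub_inSigma hk _ _⟩

lemma SN_head {k : ℕ} (hk : 2 ≤ k) (m : NN) : SN k m 0 = k - 1 := by
  unfold SN
  split_ifs
  · exact (lamList_head hk _ (by simp [baseSeq]) (inSigma_base hk)).1
  · exact Sseq_head hk _

lemma SN_inSigma {k : ℕ} (hk : 2 ≤ k) (m : NN) : InSigma k (SN k m) := by
  unfold SN
  split_ifs
  · exact (lamList_head hk _ (by simp [baseSeq]) (inSigma_base hk)).2
  · exact Sseq_inSigma hk _

/-! ### Separation of digit frequency sets -/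

/-- A certificate that `DF(w')` is not contained in `DF(w)`. -/
def Sep (k : ℕ) (w w' : Seq) : Prop :=
  ∃ (L : ℕ → ℤ) (y : List ℕ) (u : Seq), InvL k L ∧ Good w L ∧ Prep u y ∧ y ≠ [] ∧
    (∀ a ∈ y, a < k) ∧ InSigma k u ∧ k - 2 ≤ u 0 ∧ seqLe u w' ∧ wsum L y < 0

lemma sep_step {k : ℕ} (hk : 2 ≤ k) (n : ℕ) {w w' : Seq} (hw : w 0 = k - 1) (hw' : InSigma k w')
    (h : Sep k w w') : Sep k (lamSub k n w) (lamSub k n w') := by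
  obtain ⟨L, y, u, h1, h2, h3, h4, h5, h6, h7, h8, h9⟩ := h
  refine ⟨pull k n L, lamL k n y, lamSub k n u, invL_pull hk n h1, good_pull hk n h1 hw h2,
    prep_lam hk n h6 h7 h3, ?_, lamL_lt hk n y, lamSub_inSigma hk _ _, ?_,
    lamSub_le hk n hw' h8, ?_⟩
  · exact lamL_ne_nil h4
  · rw [lamSub_zero_eq hk n h7]; omega
  · rwa [wsum_pull hk n L y h5]

lemma sep_ne {k : ℕ} {w w' : Seq} (h : Sep k w w') : DFw k w ≠ DFw k w' := by
  obtain ⟨L, y, u, h1, h2, h3, h4, h5, h6, h7, h8, h9⟩ := h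
  intro he
  have hm : wfreq k y ∈ DFw k w := by
    rw [he]; exact DF_mono h8 (wfreq_mem h4 h5 h3)
  have h10 := good_DF h2 hm
  have hl : (0 : ℝ) < y.length := by exact_mod_cast List.length_pos_iff.2 h4
  have h11 : ∑ i ∈ Finset.range k, (L i : ℝ) * proj (wfreq k y) i
      = (wsum L y : ℝ) / (y.length : ℝ) := by
    rw [wsum_count L y h5]
    push_cast
    rw [Finset.sum_div]
    apply Finset.sum_congr rfl
    intro i hi
    rw [proj_wfreq y (Finset.mem_range.1 hi), mul_div_assoc]
  rw [h11] at h10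
  have h12 : (wsum L y : ℝ) < 0 := by exact_mod_cast h9
  have := div_neg_of_neg_of_pos h12 hl
  linarith

lemma good_base {a b : ℕ} {t : Seq} {L : ℕ → ℤ} (h0 : L 0 = 1) (hb : L b = -(a : ℤ))
    (hmid : ∀ i, i < b → 0 ≤ L i) : 
    Good (app (b :: List.replicate a 0) t) L := by
  refine ⟨a, fun x hx => ?_⟩
  have key : ∀ x : List ℕ, Adm (app (b :: List.replicate a 0) t) x → ∀ j, j ≤ a →
      (∀ s, s < j → x.getD s 0 = 0) → (j : ℤ) ≤ wsum L x + a := by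
    intro x
    induction x with
    | nil => intro _ j hj _; simp [wsum]; omega
    | cons c x ih =>
      intro hx j hj hz
      rw [wsum_cons]
      by_cases hcb : c = b
      · have hx1 : le x (app (List.replicate a 0) t) := by
          rcases hx.1 with h1 | h1
          · exact absurd hcb (by simpa using h1.ne)
          · simpa using h1.2
        have h2 := ih hx.2 a le_rfl (le_zeros hx1)
        rw [hcb, hb]
        by_cases hj0 : j = 0
        · subst hj0; push_cast; linarith
        · have h3 : c = 0 := by simpa using hz 0 (by omega)
          have h4 : L b = 1 := by rw [← hcb, h3, h0]
          rw [hb] at h4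
          omega
      · have hlt : c < b := by
          rcases hx.1 with h1 | h1
          · simpa using h1
          · exact absurd (by simpa using h1.1) hcb
        by_cases hj0 : j = 0
        · subst hj0
          have := ih hx.2 0 (by omega) (by simp)
          have := hmid c hlt
          push_cast at *
          linarith
        · have h3 : c = 0 := by simpa using hz 0 (by omega)
          have h4 := ih hx.2 (j - 1) (by omega) (fun s hs => by simpa using hz (s + 1) (by omega))
          rw [h3, h0]
          omega
  have := key x hx 0 (by omega) (by simp)
  push_cast at this
  linarith

lemma SN_prefix {k : ℕ} (hk : 2 ≤ k) {m : NN} {a : ℕ} (h : (a : ℕ∞) ≤ m.1 0) :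
    ∃ t, SN k m = app ((k - 1) :: List.replicate a 0) t := by
  by_cases htop : m.1 0 = ⊤
  · refine ⟨fun _ => 0, ?_⟩
    rw [SN_top htop]
    funext i
    cases i with
    | zero => rfl
    | succ i =>
      rw [app_cons, scons_succ, app_apply]
      simp [baseSeq]
  · obtain ⟨c, hc⟩ := ENat.ne_top_iff_exists.1 htop
    rw [← hc] at h
    have hac : a ≤ c := by exact_mod_cast h
    rw [SN_step hk hc.symm, lamSub_cons, SN_head hk, lamWord_top hk]
    obtain ⟨d, rfl⟩ := Nat.exists_eq_add_of_le hac
    rw [List.replicate_add, ← List.cons_append, app_append]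
    exact ⟨_, rfl⟩

lemma sep_base {k : ℕ} (hk : 2 ≤ k) {m g : NN} {g0 g1 : ℕ} (h0 : g.1 0 = g0) (h1 : g.1 1 = g1)
    (hlt : g.1 0 < m.1 0) : Sep k (SN k m) (SN k g) := by
  have ha : ((g0 + 1 : ℕ) : ℕ∞) ≤ m.1 0 := by
    rw [h0] at hlt
    exact_mod_cast Order.add_one_le_of_lt hlt
  obtain ⟨t, ht⟩ := SN_prefix hk ha
  set M : ℕ → ℤ := fun i => if i = k - 1 then -1 else 0 with hM
  have hMi : InvL k M := by
    refine ⟨by simp [hM], fun i _ => ?_⟩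
    simp only [hM]; split_ifs <;> simp
  have hlow : ∀ a ∈ [k - 2], a < k := by simp; omega
  have hc : InSigma k (fun _ => k - 2) := fun _ => by show k - 2 < k; omega
  refine ⟨pull k g0 M, lamL k g0 (lamL k g1 [k - 2]),
    lamSub k g0 (lamSub k g1 fun _ => k - 2), invL_pull hk _ hMi, ?_, ?_, ?_, lamL_lt hk _ _,
    lamSub_inSigma hk _ _, ?_, ?_, ?_⟩
  · rw [ht]
    apply good_base
    · have : ¬ (k - 2 = k - 1) := by omega
      simp [pull, hM, this]
    · have : ¬ (k - 2 = k - 1) := by omega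
      have h3 : ¬ (k - 1 = 0) := by omega
      simp [pull, hM, this, h3]
      ring
    · intro i hi
      have : ¬ (k - 2 = k - 1) := by omega
      have h3 : ¬ (i = k - 1) := by omega
      have h4 : ¬ (i - 1 = k - 1) := by omega
      simp [pull, hM, this, h3, h4]
      split_ifs <;> simp
  · apply prep_lam hk _ (lamSub_inSigma hk _ _)
    · rw [lamSub_zero_eq hk _ le_rfl]; omega
    · apply prep_lam hk _ hc le_rfl
      exact prep_const (by simp)
  · exact lamL_ne_nil (lamL_ne_nil (by simp))
  · rw [lamSub_zero_eq hk]
    · omega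
    · rw [lamSub_zero_eq hk _ le_rfl]; omega
  · rw [SN_step hk h0, SN_step hk (m := tailNN g) h1]
    apply lamSub_le hk _ (lamSub_inSigma hk _ _)
    apply lamSub_le hk _ (SN_inSigma hk _)
    apply seqLe_of_zero
    rw [SN_head hk]
    omega
  · rw [wsum_pull hk g0 M _ (lamL_lt hk _ _)]
    have : lamL k g1 [k - 2] = (k - 1) :: List.replicate (g1 + 1) 0 := by
      simp [lamL, lamWord_mid hk]
    rw [this, wsum_cons, wsum_replicate]
    have h3 : ¬ (0 = k - 1) := by omega
    simp [hM, h3]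

lemma sep_main {k : ℕ} (hk : 2 ≤ k) (r : ℕ) {m g : NN} (heq : ∀ s, s < r → m.1 s = g.1 s)
    (hlt : g.1 r < m.1 r) (hg : g.1 (r + 1) ≠ ⊤) : Sep k (SN k m) (SN k g) := by
  induction r generalizing m g with
  | zero =>
    obtain ⟨c, hc⟩ := ENat.ne_top_iff_exists.1 hg
    obtain ⟨d, hd⟩ := ENat.ne_top_iff_exists.1 hlt.ne_top
    exact sep_base hk hd.symm hc.symm hlt
  | succ r ih =>
    have hnt : g.1 0 ≠ ⊤ := by
      intro h
      have : ∀ s, g.1 s = ⊤ := by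
        intro s
        induction s with
        | zero => exact h
        | succ s ihs => exact g.2 s ihs
      exact hg (this _)
    obtain ⟨c, hc⟩ := ENat.ne_top_iff_exists.1 hnt
    rw [SN_step hk hc.symm, SN_step hk ((heq 0 (by omega)).trans hc.symm)]
    apply sep_step hk _ (SN_head hk _) (SN_inSigma hk _)
    exact ih (m := tailNN m) (g := tailNN g) (fun s hs => heq (s + 1) (by omega)) hlt hg

/-! ### Rational-finite pairs -/

lemma lamSub_const {k : ℕ} (hk : 2 ≤ k) (c : ℕ) :
    lamSub k (c + 1) (topSeq k) = lamSub k c (fun _ => k - 2) := by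
  funext i
  unfold lamSub topSeq
  simp only [lamWord_top hk, lamWord_mid hk]

lemma pair_base {k : ℕ} (hk : 2 ≤ k) (c : ℕ) :
    seqLe (lamSub k c (fun _ => k - 2)) (lamSub k c (baseSeq k)) ∧
    Trel k (lamSub k c (baseSeq k)) (lamSub k c (fun _ => k - 2)) := by
  constructor
  · apply lamSub_le hk _ (inSigma_base hk)
    apply seqLe_of_zero
    simp [baseSeq]; omega
  · apply trel_step hk _ (trel_base hk) (by simp [baseSeq]) _ le_rfl
    exact fun _ => by show k - 2 < k; omega

lemma pair_rel {k : ℕ} (hk : 2 ≤ k) (R : ℕ) (f : ℕ → ℕ) :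
    seqLe (SN k (toNN (ratSeq f R))) (SN k (finNN f R)) ∧
    Trel k (SN k (finNN f R)) (SN k (toNN (ratSeq f R))) := by
  induction R generalizing f with
  | zero =>
    have h1 : SN k (finNN f 0) = lamSub k (f 0) (baseSeq k) := by
      rw [SN_step hk (c := f 0) (by simp [finNN]), SN_top (by simp [tailNN, finNN])]
    have h2 : SN k (toNN (ratSeq f 0)) = lamSub k (f 0) (fun _ => k - 2) := by
      rw [SN_step hk (c := f 0 + 1) (by simp [toNN, ratSeq]), ← lamSub_const hk]
      congr 1
      have h3 : ¬ ∃ R, (tailNN (toNN (ratSeq f 0))).1 R = ⊤ := by simp [tailNN, toNN]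
      unfold SN
      rw [dif_neg h3, ← Sseq_zero hk]
      congr 1
    rw [h1, h2]
    exact pair_base hk _
  | succ R ih =>
    have h1 : tailNN (finNN f (R + 1)) = finNN (fun r => f (r + 1)) R := by
      apply Subtype.ext; funext r
      simp [tailNN, finNN]
    have h2 : tailNN (toNN (ratSeq f (R + 1))) = toNN (ratSeq (fun r => f (r + 1)) R) := by
      apply Subtype.ext; funext r
      simp [tailNN, toNN, ratSeq]
    rw [SN_step hk (m := finNN f (R + 1)) (c := f 0) (by simp [finNN]),
      SN_step hk (m := toNN (ratSeq f (R + 1))) (c := f 0) (by simp [toNN, ratSeq]), h1, h2]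
    obtain ⟨h3, h4⟩ := ih fun r => f (r + 1)
    exact ⟨lamSub_le hk _ (SN_inSigma hk _) h3, trel_step hk _ h4 (SN_head hk _) (SN_inSigma hk _)
      (by rw [SN_head hk]; omega)⟩

lemma pair_DF {k : ℕ} (hk : 2 ≤ k) (R : ℕ) (f : ℕ → ℕ) :
    DFN k (toNN (ratSeq f R)) = DFN k (finNN f R) := by
  obtain ⟨h1, h2⟩ := pair_rel hk R f
  exact Set.Subset.antisymm (DF_mono h1) (trel_DF hk h2 (SN_head hk _))

lemma first_diff {m n : NN} (h : m ≠ n) :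
    ∃ r, (∀ s, s < r → m.1 s = n.1 s) ∧ m.1 r ≠ n.1 r := by
  have hex : ∃ r, m.1 r ≠ n.1 r := by
    by_contra hc
    push Not at hc
    exact h (Subtype.ext (funext hc))
  refine ⟨Nat.find hex, fun s hs => ?_, Nat.find_spec hex⟩
  have := Nat.find_min hex hs
  push Not at this
  exact this

lemma NN_top_of_le {n : NN} {r : ℕ} (h : n.1 r = ⊤) {s : ℕ} (hs : r ≤ s) : n.1 s = ⊤ := by
  induction s, hs using Nat.le_induction with
  | base => exact h
  | succ s _ ih => exact n.2 s ih

/-- If the first difference has `m` larger and the sets agree, then we have a pair. -/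
lemma pair_of_eq {k : ℕ} (hk : 2 ≤ k) {m n : NN} (hD : DFN k m = DFN k n) {r : ℕ}
    (heq : ∀ s, s < r → m.1 s = n.1 s) (hlt : n.1 r < m.1 r) :
    ∃ f, m = toNN (ratSeq f r) ∧ n = finNN f r := by
  by_cases htop : n.1 (r + 1) = ⊤
  swap
  · exact absurd hD (sep_ne (sep_main hk r heq hlt htop))
  have hfin : ∀ s, s ≤ r → n.1 s ≠ ⊤ := fun s hs h => hlt.ne_top (NN_top_of_le h hs)
  set f : ℕ → ℕ := fun s => (n.1 s).toNat with hf
  have hfc : ∀ s, s ≤ r → (f s : ℕ∞) = n.1 s := fun s hs => ENat.natCast_toNat (hfin s hs)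
  have hn : n = finNN f r := by
    apply Subtype.ext; funext s
    simp only [finNN]
    split_ifs with h
    · exact (hfc s h).symm
    · exact NN_top_of_le htop (by omega)
  refine ⟨f, ?_, hn⟩
  by_contra hne
  obtain ⟨q, hq1, hq2⟩ := first_diff hne
  have hDp : DFN k m = DFN k (toNN (ratSeq f r)) := by rw [hD, hn, pair_DF hk]
  have hqlt : (toNN (ratSeq f r)).1 q < m.1 q := by
    apply lt_of_le_of_ne _ (Ne.symm hq2)
    show ((ratSeq f r q : ℕ) : ℕ∞) ≤ m.1 q
    unfold ratSeq
    split_ifs with h1 h2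
    · rw [hfc q h1.le, heq q h1]
    · rw [h2]
      push_cast
      rw [hfc r le_rfl]
      exact Order.add_one_le_of_lt hlt
    · simp
  exact sep_ne (sep_main hk q hq1 hqlt (by simp [toNN])) hDp

/-- distinct `m, n ∈ N` have `DF(m) = DF(n)` iff they form a
rational-finite pair. -/
theorem stmt9 (k : ℕ) (hk : 2 ≤ k) (m n : NN) (hmn : m ≠ n) :
    DFN k m = DFN k n ↔
      ∃ (R : ℕ) (f : ℕ → ℕ), ({m, n} : Set NN) = {toNN (ratSeq f R), finNN f R} := by
  constructor
  · intro hD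
    obtain ⟨r, h1, h2⟩ := first_diff hmn
    rcases lt_or_gt_of_ne h2 with h3 | h3
    · obtain ⟨f, h4, h5⟩ := pair_of_eq hk hD.symm (fun s hs => (h1 s hs).symm) h3
      exact ⟨r, f, by rw [Set.pair_comm, ← h4, ← h5]⟩
    · obtain ⟨f, h4, h5⟩ := pair_of_eq hk hD h1 h3
      exact ⟨r, f, by rw [← h4, ← h5]⟩
  · rintro ⟨R, f, h⟩
    rcases Set.pair_eq_pair_iff.1 h with ⟨rfl, rfl⟩ | ⟨rfl, rfl⟩
    · exact pair_DF hk R f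
    · exact (pair_DF hk R f).symm

end BetaDF
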